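/- arXiv:2011.09227 — 2 statements merged into one kernel-verified Lean document; each statement's English description precedes it below -/
import Mathlib

section
/- Let M be an indecomposable rank-3 module in CM(B_{3,9}) admitting a filtration L_{I_1} | L_{I_2} | L_{I_3} where the ordered triple (I_1, I_2, I_3) is a cyclic permutation of ({3,6,9}, {2,5,8}, {1,4,7}). Then M is not rigid, i.e. there exists a short exact sequence 0 → M → E → M → 0 in CM(B_{3,9}) that does not split. -/
open scoped Classical

noncomputable section

namespace GCC

/-- The base ring `R = ℂ⟦t⟧` of formal power series. -/
abbrev Rser : Type := PowerSeries ℂ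

/-- The power series variable `t`. -/
noncomputable def tser : Rser := PowerSeries.X

/-- The cyclic product `X i * X (i-1) * ⋯ * X (i-(n-1))`, i.e.
`X_{i+n} · X_{i+n-1} · ⋯ · X_{i+1}` with indices read modulo `n`. -/
def cycProd {n s : ℕ} (X : ZMod n → Matrix (Fin s) (Fin s) Rser) (i : ZMod n) :
    Matrix (Fin s) (Fin s) Rser :=
  ((List.range n).map fun j => X (i - (j : ZMod n))).prod

/-- A (maximal) Cohen–Macaulay `B_{k,n}`-module of rank `s`: a family of `s × s`
matrices `X i`, `Y i` over `ℂ⟦t⟧`, indexed by `ℤ/n`, subject to the relations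
`X i * Y i = t·Id`, `Y i * X i = t·Id`, and the cyclic relation
`X_{i+n} ⋯ X_{i+1} = t^(n-k)·Id`. -/
structure CMMod (k n s : ℕ) : Type where
  X : ZMod n → Matrix (Fin s) (Fin s) Rser
  Y : ZMod n → Matrix (Fin s) (Fin s) Rser
  hXY : ∀ i, X i * Y i = tser • (1 : Matrix (Fin s) (Fin s) Rser)
  hYX : ∀ i, Y i * X i = tser • (1 : Matrix (Fin s) (Fin s) Rser)
  hcyc : ∀ i, cycProd X i = (tser ^ (n - k)) • (1 : Matrix (Fin s) (Fin s) Rser)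

/-- A morphism of Cohen–Macaulay `B_{k,n}`-modules: a family of matrices
`F i` with `F i * X i = X' i * F (i-1)` and `F (i-1) * Y i = Y' i * F i`. -/
structure CMHom {k n s s' : ℕ} (M : CMMod k n s) (M' : CMMod k n s') : Type where
  F : ZMod n → Matrix (Fin s') (Fin s) Rser
  hX : ∀ i, F i * M.X i = M'.X i * F (i - 1)
  hY : ∀ i, F (i - 1) * M.Y i = M'.Y i * F i

/-- `M` is indecomposable: its only idempotent endomorphisms are `0` and the identity. -/
def Indecomposable {k n s : ℕ} (M : CMMod k n s) : Prop :=
  ∀ f : CMHom M M, (∀ i, f.F i * f.F i = f.F i) → (∀ i, f.F i = 0) ∨ (∀ i, f.F i = 1)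

/-- A short exact sequence `0 → A → E → B → 0` in `CM(B_{k,n})`: a pair of
morphisms that is exact at each index `i` as a sequence of `R`-modules. -/
structure CMses {k n sA sE sB : ℕ} (A : CMMod k n sA) (E : CMMod k n sE)
    (B : CMMod k n sB) : Type where
  emb : CMHom A E
  quo : CMHom E B
  inj : ∀ i, Function.Injective ((emb.F i).mulVecLin)
  exactness : ∀ i, LinearMap.range ((emb.F i).mulVecLin) = LinearMap.ker ((quo.F i).mulVecLin)
  surj : ∀ i, Function.Surjective ((quo.F i).mulVecLin)

/-- A short exact sequence splits if some morphism `ρ : E → A` satisfies `ρ ∘ ι = id`. -/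
def CMses.Splits {k n sA sE sB : ℕ} {A : CMMod k n sA} {E : CMMod k n sE} {B : CMMod k n sB}
    (S : CMses A E B) : Prop :=
  ∃ ρ : CMHom E A, ∀ i, ρ.F i * S.emb.F i = 1

/-- `M` is rigid: every short exact sequence `0 → M → E → M → 0` splits. -/
def Rigid {k n s : ℕ} (M : CMMod k n s) : Prop :=
  ∀ (sE : ℕ) (E : CMMod k n sE) (S : CMses M E M), S.Splits

/-- `N` is the rank-1 module `L_I`: `X i = 1`, `Y i = t` for `i ∈ I`, and
`X i = t`, `Y i = 1` for `i ∉ I`. -/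
def IsRankOne {k n : ℕ} (I : Finset (ZMod n)) (N : CMMod k n 1) : Prop :=
  (∀ i, N.X i = if i ∈ I then 1 else tser • 1) ∧
  (∀ i, N.Y i = if i ∈ I then tser • 1 else 1)

/-- `M` admits the filtration `L_{I₁} | L_{I₂} | ⋯ | L_{Iₘ}`: there are modules
`M = N₁, N₂, …, Nₘ = L_{Iₘ}` and short exact sequences
`0 → N_{j+1} → N_j → L_{I_j} → 0`. -/
inductive HasFiltration {k n : ℕ} : {s : ℕ} → CMMod k n s → List (Finset (ZMod n)) → Prop
  | base {I : Finset (ZMod n)} {N : CMMod k n 1} : IsRankOne I N → HasFiltration N [I]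
  | step {s s' : ℕ} {N : CMMod k n s} {M : CMMod k n s'} {Q : CMMod k n 1}
      {I : Finset (ZMod n)} {rest : List (Finset (ZMod n))} :
      IsRankOne I Q → HasFiltration N rest → Nonempty (CMses N M Q) →
      HasFiltration M (I :: rest)

section LinearAlgebra

variable {V : Type*} [AddCommGroup V] [Module ℂ V] [FiniteDimensional ℂ V]

/-- Three endomorphisms of a three-dimensional space with at most one-dimensional kernels and
zero product define a full flag; its stabiliser lies in the kernel of a surjection to `ℂ³`. -/
theorem exists_flag_functional (hV : Module.finrank ℂ V = 3) (f₁ f₂ f₃ : Module.End ℂ V)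
    (h₁ : Module.finrank ℂ (LinearMap.ker f₁) ≤ 1) (h₂ : Module.finrank ℂ (LinearMap.ker f₂) ≤ 1)
    (h₃ : Module.finrank ℂ (LinearMap.ker f₃) ≤ 1) (h : f₁ * f₂ * f₃ = 0) :
    ∃ l : Module.End ℂ V →ₗ[ℂ] ℂ × ℂ × ℂ, Function.Surjective l ∧
      ∀ A B C : Module.End ℂ V, A * f₁ = f₁ * B → B * f₂ = f₂ * C → l A = 0 := by
  have r₁ := f₁.finrank_range_add_finrank_ker
  have r₂ := f₂.finrank_range_add_finrank_ker
  have r₃ := f₃.finrank_range_add_finrank_ker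
  have r₁₂ := (f₁ * f₂).finrank_range_add_finrank_ker
  have k₂₃ : f₂ * f₃ ≠ 0 := fun h0 => by
    have := Submodule.finrank_mono (LinearMap.range_le_ker_iff.2 h0)
    omega
  have k₁₂ : f₁ * f₂ ≠ 0 := fun h0 => by
    have := Submodule.finrank_mono (LinearMap.range_le_ker_iff.2 h0)
    omega
  have k : Module.finrank ℂ (LinearMap.range (f₁ * f₂)) ≤ 1 := by
    have := Submodule.finrank_mono (LinearMap.range_le_ker_iff.2 h)
    omega
  obtain ⟨z, hz⟩ : ∃ z, z ∉ LinearMap.range f₁ := by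
    by_contra! hs
    have hinj : Function.Injective f₁ := LinearMap.injective_iff_surjective.2 hs
    refine k₂₃ (LinearMap.ext fun v => hinj ?_)
    simpa [mul_assoc] using LinearMap.congr_fun h v
  obtain ⟨x, hx⟩ : ∃ x, f₁ (f₂ x) ≠ 0 := by
    by_contra! hs
    exact k₁₂ (LinearMap.ext hs)
  obtain ⟨y, hy⟩ : ∃ y, f₁ y ∉ LinearMap.range (f₁ * f₂) := by
    by_contra! hs
    have : LinearMap.range f₁ ≤ LinearMap.range (f₁ * f₂) := by
      rintro _ ⟨y, rfl⟩
      exact hs y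
    have := Submodule.finrank_mono this
    omega
  obtain ⟨φ, hφz, hφ⟩ := Submodule.exists_le_ker_of_notMem hz
  obtain ⟨ψ, hψy, hψ⟩ := Submodule.exists_le_ker_of_notMem hy
  obtain ⟨η, hηx, -⟩ := Submodule.exists_le_ker_of_notMem
    (p := (⊥ : Submodule ℂ V)) (v := f₁ (f₂ x)) (by simpa using hx)
  have hφ' : ∀ v, φ (f₁ v) = 0 := fun v => hφ ⟨v, rfl⟩
  have hψ' : ∀ v, ψ (f₁ (f₂ v)) = 0 := fun v => hψ ⟨v, rfl⟩
  let l : Module.End ℂ V →ₗ[ℂ] ℂ × ℂ × ℂ :=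
    { toFun := fun A => (φ (A (f₁ (f₂ x))), φ (A (f₁ y)), ψ (A (f₁ (f₂ x))))
      map_add' := fun A B => by simp
      map_smul' := fun c A => by simp }
  refine ⟨l, ?_, ?_⟩
  · rintro ⟨a, b, c⟩
    let η₂ : V →ₗ[ℂ] ℂ := (ψ (f₁ y))⁻¹ • ψ
    let η₁ : V →ₗ[ℂ] ℂ := (η (f₁ (f₂ x)))⁻¹ • (η - η (f₁ y) • η₂)
    let z₂ : V := (ψ (f₁ y))⁻¹ • f₁ y
    let z₁ : V := (φ z)⁻¹ • (z - ψ z • z₂)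
    have e₁ : η₁ (f₁ (f₂ x)) = 1 := by simp [η₁, η₂, hψ', hηx]
    have e₂ : η₁ (f₁ y) = 0 := by simp [η₁, η₂, hψy]
    have e₃ : η₂ (f₁ (f₂ x)) = 0 := by simp [η₂, hψ']
    have e₄ : η₂ (f₁ y) = 1 := by simp [η₂, hψy]
    have e₅ : φ z₁ = 1 := by simp [z₁, z₂, hφ', hφz]
    have e₆ : ψ z₁ = 0 := by simp [z₁, z₂, hψy]
    have e₇ : φ z₂ = 0 := by simp [z₂, hφ']
    have e₈ : ψ z₂ = 1 := by simp [z₂, hψy]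
    exact ⟨a • η₁.smulRight z₁ + b • η₂.smulRight z₁ + c • η₁.smulRight z₂,
      by simp [l, e₁, e₂, e₃, e₄, e₅, e₆, e₇, e₈]⟩
  · intro A B C hAB hBC
    have hA : ∀ v, A (f₁ v) = f₁ (B v) := LinearMap.congr_fun hAB
    have hB : ∀ v, B (f₂ v) = f₂ (C v) := LinearMap.congr_fun hBC
    simp [l, hA, hB, hφ', hψ']

end LinearAlgebra

section Reduction

/-- Reduction modulo `t` of a matrix of power series. -/
def red {m n : Type*} (A : Matrix m n Rser) : Matrix m n ℂ :=
  A.map (PowerSeries.constantCoeff (R := ℂ))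

/-- Constant power series lift of a complex matrix. -/
def lift {m n : Type*} (A : Matrix m n ℂ) : Matrix m n Rser :=
  A.map (PowerSeries.C (R := ℂ))

theorem red_lift {m n : Type*} (A : Matrix m n ℂ) : red (lift A) = A := by
  ext i j
  simp [red, lift]

theorem red_add {m n : Type*} (A B : Matrix m n Rser) : red (A + B) = red A + red B := by
  ext i j
  simp [red]

theorem red_mul {l m n : Type*} [Fintype m] (A : Matrix l m Rser) (B : Matrix m n Rser) :
    red (A * B) = red A * red B :=
  Matrix.map_mul

theorem red_one {m : Type*} [DecidableEq m] : red (1 : Matrix m m Rser) = 1 :=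
  Matrix.map_one _ (map_zero _) (map_one _)

theorem red_mulVec {m n : Type*} [Fintype n] (A : Matrix m n Rser) (v : n → Rser) :
    (fun i => PowerSeries.constantCoeff (R := ℂ) ((A.mulVec v) i)) =
      (red A).mulVec (fun i => PowerSeries.constantCoeff (R := ℂ) (v i)) :=
  funext fun i => RingHom.map_mulVec (PowerSeries.constantCoeff (R := ℂ)) A v i

theorem tser_ne_zero : tser ≠ 0 := PowerSeries.X_ne_zero

theorem constantCoeff_comp_eq_zero_iff {n : Type*} (v : n → Rser) :
    (fun i => PowerSeries.constantCoeff (R := ℂ) (v i)) = 0 ↔ ∃ w : n → Rser, v = tser • w := by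
  constructor
  · intro h
    have : ∀ i, ∃ w, v i = tser * w := fun i => PowerSeries.X_dvd_iff.2 (congrFun h i)
    choose w hw using this
    exact ⟨w, funext hw⟩
  · rintro ⟨w, rfl⟩
    ext i
    simp [tser]

theorem exists_constantCoeff_comp_eq {n : Type*} (v : n → ℂ) :
    ∃ w : n → Rser, (fun i => PowerSeries.constantCoeff (R := ℂ) (w i)) = v :=
  ⟨fun i => PowerSeries.C (v i), by simp⟩

theorem exists_eq_tser_smul {m n : Type*} [Fintype n] [DecidableEq n] (A : Matrix m n Rser)
    (h : ∀ v, ∃ w, A.mulVec v = tser • w) : ∃ B : Matrix m n Rser, A = tser • B := by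
  choose w hw using h
  refine ⟨Matrix.of fun i j => w (Pi.single j 1) i, ?_⟩
  ext1 i j
  simpa using congrFun (hw (Pi.single j 1)) i

variable {k n sA sE sB : ℕ} {A : CMMod k n sA} {E : CMMod k n sE} {B : CMMod k n sB}

theorem CMses.quo_emb (S : CMses A E B) (i : ZMod n) (v : Fin sA → Rser) :
    (S.quo.F i).mulVec ((S.emb.F i).mulVec v) = 0 := by
  have : (S.emb.F i).mulVecLin v ∈ LinearMap.ker ((S.quo.F i).mulVecLin) :=
    S.exactness i ▸ LinearMap.mem_range_self _ v
  simpa using this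

theorem CMses.exists_emb (S : CMses A E B) (i : ZMod n) (v : Fin sE → Rser)
    (hv : (S.quo.F i).mulVec v = 0) : ∃ a, v = (S.emb.F i).mulVec a := by
  have : v ∈ LinearMap.range ((S.emb.F i).mulVecLin) := by
    rw [S.exactness i]
    simpa using hv
  obtain ⟨a, ha⟩ := this
  exact ⟨a, by simpa using ha.symm⟩

theorem CMses.red_emb_injective (S : CMses A E B) (i : ZMod n) :
    Function.Injective (red (S.emb.F i)).mulVecLin := by
  rw [← LinearMap.ker_eq_bot, LinearMap.ker_eq_bot']
  intro v hv
  obtain ⟨v, rfl⟩ := exists_constantCoeff_comp_eq v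
  rw [Matrix.mulVecLin_apply, ← red_mulVec, constantCoeff_comp_eq_zero_iff] at hv
  obtain ⟨w, hw⟩ := hv
  have h0 := S.quo_emb i v
  rw [hw, Matrix.mulVec_smul] at h0
  obtain ⟨a, rfl⟩ := S.exists_emb i w ((smul_eq_zero.1 h0).resolve_left tser_ne_zero)
  rw [constantCoeff_comp_eq_zero_iff]
  refine ⟨a, S.inj i ?_⟩
  simpa [Matrix.mulVec_smul] using hw

theorem CMses.red_exact (S : CMses A E B) (i : ZMod n) (v : Fin sE → ℂ)
    (hv : (red (S.quo.F i)).mulVec v = 0) : ∃ a, v = (red (S.emb.F i)).mulVec a := by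
  obtain ⟨v, rfl⟩ := exists_constantCoeff_comp_eq v
  rw [← red_mulVec, constantCoeff_comp_eq_zero_iff] at hv
  obtain ⟨w, hw⟩ := hv
  obtain ⟨u, hu⟩ := S.surj i w
  rw [Matrix.mulVecLin_apply] at hu
  obtain ⟨a, ha⟩ := S.exists_emb i (v - tser • u) (by
    rw [Matrix.mulVec_sub, Matrix.mulVec_smul, hu, hw, sub_self])
  refine ⟨_, Eq.trans ?_ (red_mulVec (S.emb.F i) a)⟩
  rw [← ha]
  ext j
  simp [tser]

/-- The nullity of `Y i` modulo `t`. -/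
def nullity (M : CMMod k n sE) (i : ZMod n) : ℕ :=
  Module.finrank ℂ (LinearMap.ker (red (M.Y i)).mulVecLin)

theorem CMses.nullity_le (S : CMses A E B) (i : ZMod n) :
    nullity E i ≤ nullity A i + nullity B i := by
  have hE := congrArg red (S.emb.hY i)
  have hB := congrArg red (S.quo.hY i)
  simp only [red_mul] at hE hB
  have hEv : ∀ v, (red (S.emb.F (i - 1))).mulVec ((red (A.Y i)).mulVec v) =
      (red (E.Y i)).mulVec ((red (S.emb.F i)).mulVec v) := fun v => by
    simp [Matrix.mulVec_mulVec, hE]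
  have hBv : ∀ v, (red (S.quo.F (i - 1))).mulVec ((red (E.Y i)).mulVec v) =
      (red (B.Y i)).mulVec ((red (S.quo.F i)).mulVec v) := fun v => by
    simp [Matrix.mulVec_mulVec, hB]
  let f := (red (S.quo.F i)).mulVecLin.domRestrict (LinearMap.ker (red (E.Y i)).mulVecLin)
  have hr : Module.finrank ℂ (LinearMap.range f) ≤ nullity B i := by
    refine Submodule.finrank_mono ?_
    rintro _ ⟨⟨v, hv⟩, rfl⟩
    have hv' : (red (E.Y i)).mulVec v = 0 := by simpa using hv
    simp [f, ← hBv, hv']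
  have hk : Module.finrank ℂ (LinearMap.ker f) ≤ nullity A i := by
    have h1 : (LinearMap.ker f).map (Submodule.subtype _) ≤
        (LinearMap.ker (red (A.Y i)).mulVecLin).map (red (S.emb.F i)).mulVecLin := by
      rintro _ ⟨⟨v, hv⟩, hvf, rfl⟩
      have hv' : (red (E.Y i)).mulVec v = 0 := by simpa using hv
      obtain ⟨a, rfl⟩ := S.red_exact i v (by simpa [f] using hvf)
      refine ⟨a, ?_, rfl⟩
      have : (red (S.emb.F (i - 1))).mulVecLin ((red (A.Y i)).mulVec a) = 0 := by
        simp [hEv, hv']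
      simpa using (map_eq_zero_iff _ (S.red_emb_injective (i - 1))).1 this
    have h2 := Submodule.finrank_mono h1
    rw [Submodule.finrank_map_subtype_eq] at h2
    exact h2.trans (Submodule.finrank_map_le _ _)
  have := f.finrank_range_add_finrank_ker
  unfold nullity at *
  omega

theorem IsRankOne.nullity_le {I : Finset (ZMod n)} {N : CMMod k n 1} (h : IsRankOne I N)
    (i : ZMod n) : nullity N i ≤ if i ∈ I then 1 else 0 := by
  have h2 := h.2 i
  split_ifs at h2 ⊢ with hi
  · exact (Submodule.finrank_le _).trans (by simp)
  · simp [nullity, h2, red_one]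

theorem HasFiltration.nullity_le {s : ℕ} {M : CMMod k n s} {L : List (Finset (ZMod n))}
    (h : HasFiltration M L) (i : ZMod n) :
    nullity M i ≤ (L.map fun I => if i ∈ I then 1 else 0).sum := by
  induction h with
  | base h => simpa using h.nullity_le i
  | step hQ _ hS ih =>
    obtain ⟨S⟩ := hS
    have h1 := S.nullity_le i
    have h2 := hQ.nullity_le i
    rw [List.map_cons, List.sum_cons]
    omega

theorem CMses.exists_mulVec_eq (S : CMses A E B) (i : ZMod n)
    (hB : B.Y i = tser • 1) (v : Fin sE → Rser) :
    ∃ w a, (E.Y i).mulVec v = tser • w + (S.emb.F (i - 1)).mulVec a := by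
  obtain ⟨w, hw⟩ := S.surj (i - 1) ((S.quo.F i).mulVec v)
  rw [Matrix.mulVecLin_apply] at hw
  obtain ⟨a, ha⟩ := S.exists_emb (i - 1) ((E.Y i).mulVec v - tser • w) (by
    rw [Matrix.mulVec_sub, Matrix.mulVec_smul, hw, Matrix.mulVec_mulVec, S.quo.hY i, hB]
    simp [Matrix.smul_mulVec])
  exact ⟨w, a, by rw [← ha]; abel⟩

theorem HasFiltration.exists_mul_eq {s : ℕ} {M : CMMod k n s} {I₁ I₂ I₃ : Finset (ZMod n)}
    (h : HasFiltration M [I₁, I₂, I₃]) (i : ZMod n) (h₃ : i + 1 ∈ I₃) (h₂ : i + 2 ∈ I₂)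
    (h₁ : i + 3 ∈ I₁) :
    ∃ U, M.Y (i + 1) * M.Y (i + 2) * M.Y (i + 3) = tser • U := by
  have a₂ : i + 2 - 1 = i + 1 := by ring
  have a₃ : i + 3 - 1 = i + 2 := by ring
  refine exists_eq_tser_smul _ fun v => ?_
  rcases h with _ | ⟨hQ, hN, ⟨S⟩⟩
  rcases hN with _ | ⟨hQ', hN', ⟨S'⟩⟩
  rcases hN' with hN' | ⟨_, hN'', _⟩
  · obtain ⟨w, a, h⟩ := S.exists_mulVec_eq (i + 3) (by simp [hQ.2, h₁]) v
    obtain ⟨w', a', h'⟩ := S'.exists_mulVec_eq (i + 2) (by simp [hQ'.2, h₂]) a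
    have e₂ := S.emb.hY (i + 2)
    have e₁ := S.emb.hY (i + 1)
    have e' := S'.emb.hY (i + 1)
    rw [hN'.2 (i + 1), if_pos h₃] at e'
    rw [a₃] at h
    rw [a₂] at h' e₂
    refine ⟨(M.Y (i + 1) * M.Y (i + 2)).mulVec w + (M.Y (i + 1) * S.emb.F (i + 1)).mulVec w' +
      (S.emb.F (i + 1 - 1) * S'.emb.F (i + 1 - 1)).mulVec a', ?_⟩
    calc (M.Y (i + 1) * M.Y (i + 2) * M.Y (i + 3)).mulVec v
        = tser • (M.Y (i + 1) * M.Y (i + 2)).mulVec w +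
            (M.Y (i + 1) * (M.Y (i + 2) * S.emb.F (i + 2))).mulVec a := by
          rw [← Matrix.mulVec_mulVec, h, Matrix.mulVec_add, Matrix.mulVec_smul,
            Matrix.mulVec_mulVec, Matrix.mul_assoc]
      _ = tser • (M.Y (i + 1) * M.Y (i + 2)).mulVec w +
            (tser • (M.Y (i + 1) * S.emb.F (i + 1)).mulVec w' +
              (M.Y (i + 1) * S.emb.F (i + 1) * S'.emb.F (i + 1)).mulVec a') := by
          rw [← e₂, ← Matrix.mul_assoc, ← Matrix.mulVec_mulVec a, h', Matrix.mulVec_add,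
            Matrix.mulVec_smul, Matrix.mulVec_mulVec]
      _ = _ := by
          rw [← e₁, Matrix.mul_assoc _ _ (S'.emb.F (i + 1)), ← e']
          simp [smul_add, Matrix.smul_mulVec, add_assoc]
  · cases hN''

end Reduction

section Deformation

/-- The cyclic product `X i * X (i - 1) * ⋯ * X (i - (n - 1))` in a monoid. -/
def cyclicProd {A : Type*} [Monoid A] {n : ℕ} (X : ZMod n → A) (i : ZMod n) : A :=
  ((List.range n).map fun j : ℕ => X (i - (j : ZMod n))).prod

theorem cycProd_eq_cyclicProd {n s : ℕ} (X : ZMod n → Matrix (Fin s) (Fin s) Rser) (i : ZMod n) :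
    cycProd X i = cyclicProd X i := by
  simp [cycProd, cyclicProd, ← List.map_eq_flatMap, Function.comp_def]

/-- If the cyclic product is a scalar at one position, it is the same scalar at all positions. -/
theorem cyclicProd_eq_smul_one {n : ℕ} [NeZero n] {m : Type*} [Fintype m] [DecidableEq m]
    {X Y : ZMod n → Matrix m m Rser} (hXY : ∀ i, X i * Y i = tser • (1 : Matrix m m Rser))
    (c : Rser) (o : ZMod n) (h : cyclicProd X o = c • (1 : Matrix m m Rser)) (i : ZMod n) :
    cyclicProd X i = c • (1 : Matrix m m Rser) := by
  have key : ∀ i, cyclicProd X i = c • (1 : Matrix m m Rser) →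
      cyclicProd X (i + 1) = c • (1 : Matrix m m Rser) := by
    intro i hi
    have e : cyclicProd X (i + 1) * X (i + 1) = X (i + 1) * cyclicProd X i := by
      have h := List.prod_range_succ (fun j : ℕ => X (i + 1 - (j : ZMod n))) n
      rw [CharP.cast_eq_zero, sub_zero] at h
      rw [cyclicProd, ← h, List.range_succ_eq_map]
      simp [cyclicProd, Function.comp_def]
    have e2 := congrArg (· * Y (i + 1)) e
    simp only [hi, mul_assoc, hXY, mul_smul_comm, smul_mul_assoc, mul_one] at e2
    rw [smul_comm c] at e2
    exact smul_right_injective _ tser_ne_zero e2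
  have hk : ∀ k : ℕ, cyclicProd X (o + k) = c • (1 : Matrix m m Rser) := by
    intro k
    induction k with
    | zero => simpa using h
    | succ k ih => simpa [add_assoc] using key _ ih
  have := hk (i - o).val
  rwa [ZMod.natCast_zmod_val, add_sub_cancel] at this

variable {k n s : ℕ}

/-- A first-order deformation `X + εP`, `Y + εQ` of `M` gives a self-extension of `M`; it splits
only if the deformation is trivial. -/
theorem exists_ses_of_deformation (M : CMMod k n s) (P Q : ZMod n → Matrix (Fin s) (Fin s) Rser)
    (hPQ : ∀ i, M.X i * Q i + P i * M.Y i = 0) (hQP : ∀ i, M.Y i * P i + Q i * M.X i = 0)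
    (hc : ∀ i, cyclicProd (fun i => Matrix.fromBlocks (M.X i) (P i) 0 (M.X i)) i =
      (tser ^ (n - k)) • 1) :
    ∃ (sE : ℕ) (E : CMMod k n sE) (S : CMses M E M), S.Splits →
      ∃ H : ZMod n → Matrix (Fin s) (Fin s) Rser,
        ∀ i, Q i + H (i - 1) * M.Y i = M.Y i * H i := by
  let φ := Matrix.reindexAlgEquiv Rser Rser (finSumFinEquiv (m := s) (n := s))
  let E : CMMod k n (s + s) :=
    { X := fun i => φ (Matrix.fromBlocks (M.X i) (P i) 0 (M.X i))
      Y := fun i => φ (Matrix.fromBlocks (M.Y i) (Q i) 0 (M.Y i))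
      hXY := fun i => by
        rw [← map_mul, Matrix.fromBlocks_multiply]
        simp only [hPQ, M.hXY, mul_zero, zero_mul, add_zero, zero_add]
        rw [← map_one φ, ← map_smul, ← Matrix.fromBlocks_one, Matrix.fromBlocks_smul]
        simp
      hYX := fun i => by
        rw [← map_mul, Matrix.fromBlocks_multiply]
        simp only [hQP, M.hYX, mul_zero, zero_mul, add_zero, zero_add]
        rw [← map_one φ, ← map_smul, ← Matrix.fromBlocks_one, Matrix.fromBlocks_smul]
        simp
      hcyc := fun i => by
        rw [cycProd_eq_cyclicProd, ← map_one φ, ← map_smul, ← hc i, cyclicProd, cyclicProd,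
          map_list_prod, List.map_map]
        rfl }
  let e := (finSumFinEquiv (m := s) (n := s)).symm
  let ι : Matrix (Fin (s + s)) (Fin s) Rser := (Matrix.fromRows 1 0).submatrix e id
  let κ : Matrix (Fin (s + s)) (Fin s) Rser := (Matrix.fromRows 0 1).submatrix e id
  let p : Matrix (Fin s) (Fin (s + s)) Rser := (Matrix.fromCols 1 0).submatrix id e
  let q : Matrix (Fin s) (Fin (s + s)) Rser := (Matrix.fromCols 0 1).submatrix id e
  have hpι : p * ι = 1 := by
    simp [p, ι, Matrix.submatrix_mul_equiv, Matrix.fromCols_mul_fromRows]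
  have hqι : q * ι = 0 := by
    simp [q, ι, Matrix.submatrix_mul_equiv, Matrix.fromCols_mul_fromRows]
  have hqκ : q * κ = 1 := by
    simp [q, κ, Matrix.submatrix_mul_equiv, Matrix.fromCols_mul_fromRows]
  have hsum : ι * p + κ * q = 1 := by
    simp only [p, ι, q, κ]
    rw [← Matrix.submatrix_mul _ _ _ id _ Function.bijective_id,
      ← Matrix.submatrix_mul _ _ _ id _ Function.bijective_id, Matrix.fromRows_mul_fromCols,
      Matrix.fromRows_mul_fromCols]
    refine (congrFun (congrFun (Matrix.submatrix_add _ _) e) e).symm.trans ?_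
    simp [Matrix.fromBlocks_add]
  have hφ : ∀ B, φ B = B.submatrix e e := fun _ => rfl
  have hι' : ∀ A : Matrix (Fin s) (Fin s) Rser, ι * A = (Matrix.fromRows A 0).submatrix e id := by
    intro A
    conv_lhs => rw [← Matrix.submatrix_id_id A]
    rw [← Matrix.submatrix_mul _ _ _ id _ Function.bijective_id, Matrix.fromRows_mul]
    simp
  have hκ' : ∀ A : Matrix (Fin s) (Fin s) Rser, κ * A = (Matrix.fromRows 0 A).submatrix e id := by
    intro A
    conv_lhs => rw [← Matrix.submatrix_id_id A]
    rw [← Matrix.submatrix_mul _ _ _ id _ Function.bijective_id, Matrix.fromRows_mul]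
    simp
  have hι : ∀ A B : Matrix (Fin s) (Fin s) Rser, φ (Matrix.fromBlocks A B 0 A) * ι = ι * A := by
    intro A B
    rw [hφ, hι', Matrix.submatrix_mul_equiv, Matrix.fromBlocks_mul_fromRows]
    simp
  have hκ : ∀ A B : Matrix (Fin s) (Fin s) Rser,
      φ (Matrix.fromBlocks A B 0 A) * κ = ι * B + κ * A := by
    intro A B
    rw [hφ, hι', hκ', Matrix.submatrix_mul_equiv, Matrix.fromBlocks_mul_fromRows]
    ext i j
    rcases h : e i with i' | i' <;> simp [h]
  have hq : ∀ A B : Matrix (Fin s) (Fin s) Rser, q * φ (Matrix.fromBlocks A B 0 A) = A * q := by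
    intro A B
    change _ * (Matrix.fromBlocks A B 0 A).submatrix e e = A.submatrix id id * _
    rw [Matrix.submatrix_mul_equiv, ← Matrix.submatrix_mul _ _ _ id _ Function.bijective_id,
      Matrix.fromCols_mul_fromBlocks, Matrix.mul_fromCols]
    simp
  let S : CMses M E M :=
    { emb := ⟨fun _ => ι, fun i => (hι _ _).symm, fun i => (hι _ _).symm⟩
      quo := ⟨fun _ => q, fun i => hq _ _, fun i => hq _ _⟩
      inj := fun i a b h => by
        have := congrArg p.mulVec h
        simpa [hpι] using this
      exactness := fun i => by
        ext v
        constructor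
        · rintro ⟨a, rfl⟩
          simp [hqι]
        · intro hv
          refine ⟨p.mulVec v, ?_⟩
          have hv' : q.mulVec v = 0 := by simpa using hv
          have := congrArg (fun A => A.mulVec v) hsum
          simpa [Matrix.add_mulVec, ← Matrix.mulVec_mulVec, hv'] using this
      surj := fun i v => ⟨κ.mulVec v, by simp [hqκ]⟩ }
  refine ⟨s + s, E, S, ?_⟩
  rintro ⟨ρ, hρ⟩
  refine ⟨fun i => ρ.F i * κ, fun i => ?_⟩
  have h1 := congrArg (· * κ) (ρ.hY i)
  have hE : E.Y i * κ = ι * Q i + κ * M.Y i := hκ _ _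
  have hρ' : ρ.F (i - 1) * ι = 1 := hρ (i - 1)
  simp only [Matrix.mul_assoc] at h1 ⊢
  rw [hE, Matrix.mul_add, ← Matrix.mul_assoc, hρ', Matrix.one_mul] at h1
  exact h1

end Deformation

section SelfExtension

theorem exists_matrix_flag_functional (f₁ f₂ f₃ : Matrix (Fin 3) (Fin 3) ℂ)
    (h₁ : Module.finrank ℂ (LinearMap.ker f₁.mulVecLin) ≤ 1)
    (h₂ : Module.finrank ℂ (LinearMap.ker f₂.mulVecLin) ≤ 1)
    (h₃ : Module.finrank ℂ (LinearMap.ker f₃.mulVecLin) ≤ 1) (h : f₁ * f₂ * f₃ = 0) :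
    ∃ l : Matrix (Fin 3) (Fin 3) ℂ →ₗ[ℂ] ℂ × ℂ × ℂ, Function.Surjective l ∧
      ∀ A B C : Matrix (Fin 3) (Fin 3) ℂ, A * f₁ = f₁ * B → B * f₂ = f₂ * C → l A = 0 := by
  obtain ⟨l, hl, hl'⟩ := exists_flag_functional (V := Fin 3 → ℂ) (by simp) f₁.mulVecLin
    f₂.mulVecLin f₃.mulVecLin h₁ h₂ h₃ (by
      simp only [Module.End.mul_eq_comp, ← Matrix.mulVecLin_mul, h, Matrix.mulVecLin_zero])
  refine ⟨l ∘ₗ Matrix.toLin'.toLinearMap, hl.comp Matrix.toLin'.surjective, ?_⟩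
  intro A B C hAB hBC
  refine hl' A.mulVecLin B.mulVecLin C.mulVecLin ?_ ?_ <;>
    simp only [Module.End.mul_eq_comp, ← Matrix.mulVecLin_mul, hAB, hBC]

theorem cyclicProd_nine {A : Type*} [Monoid A] (X : ZMod 9 → A) (i : ZMod 9) :
    cyclicProd X i = (X (i + 6 + 3) * X (i + 6 + 2) * X (i + 6 + 1)) *
      ((X (i + 3 + 3) * X (i + 3 + 2) * X (i + 3 + 1)) * (X (i + 3) * X (i + 2) * X (i + 1))) := by
  have h : ∀ i : ZMod 9, i + 6 + 3 = i ∧ i + 6 + 2 = i - 1 ∧ i + 6 + 1 = i - 2 ∧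
      i + 3 + 3 = i - 3 ∧ i + 3 + 2 = i - 4 ∧ i + 3 + 1 = i - 5 ∧ i + 3 = i - 6 ∧
      i + 2 = i - 7 ∧ i + 1 = i - 8 := by decide
  obtain ⟨h0, h1, h2, h3, h4, h5, h6, h7, h8⟩ := h i
  rw [h0, h1, h2, h3, h4, h5, h6, h7, h8]
  simp [cyclicProd, List.range_succ, mul_assoc]

variable {M : CMMod 3 9 3}

theorem CMMod.triple_mul_triple (M : CMMod 3 9 3) (i : ZMod 9) :
    (M.X (i + 3) * M.X (i + 2) * M.X (i + 1)) * (M.Y (i + 1) * M.Y (i + 2) * M.Y (i + 3)) =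
      tser ^ 3 • (1 : Matrix (Fin 3) (Fin 3) Rser) := by
  calc _ = M.X (i + 3) * (M.X (i + 2) * (M.X (i + 1) * M.Y (i + 1)) * M.Y (i + 2)) *
        M.Y (i + 3) := by simp only [mul_assoc]
    _ = _ := by
      simp only [M.hXY, mul_smul_comm, smul_mul_assoc, mul_one, smul_smul]
      congr 1
      ring

/-- If the products of three consecutive maps `Y`, starting after the indices in `S`, are
divisible by `t`, the quotients around the cycle multiply to the identity. -/
theorem CMMod.mul_mul_eq_one (U : ZMod 9 → Matrix (Fin 3) (Fin 3) Rser) (i : ZMod 9)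
    (h₀ : M.Y (i + 1) * M.Y (i + 2) * M.Y (i + 3) = tser • U i)
    (h₃ : M.Y (i + 3 + 1) * M.Y (i + 3 + 2) * M.Y (i + 3 + 3) = tser • U (i + 3))
    (h₆ : M.Y (i + 6 + 1) * M.Y (i + 6 + 2) * M.Y (i + 6 + 3) = tser • U (i + 6)) :
    U i * U (i + 3) * U (i + 6) = 1 := by
  have hc := M.hcyc i
  rw [cycProd_eq_cyclicProd, cyclicProd_nine] at hc
  have e₀ := M.triple_mul_triple i
  have e₃ := M.triple_mul_triple (i + 3)
  have e₆ := M.triple_mul_triple (i + 6)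
  rw [h₀] at e₀
  rw [h₃] at e₃
  rw [h₆] at e₆
  generalize M.X (i + 3) * M.X (i + 2) * M.X (i + 1) = Z₀ at *
  generalize M.X (i + 3 + 3) * M.X (i + 3 + 2) * M.X (i + 3 + 1) = Z₃ at *
  generalize M.X (i + 6 + 3) * M.X (i + 6 + 2) * M.X (i + 6 + 1) = Z₆ at *
  have key : ∀ A₀ A₃ A₆ : Matrix (Fin 3) (Fin 3) Rser, Z₀ * A₀ = tser ^ 3 • 1 →
      Z₃ * A₃ = tser ^ 3 • 1 → Z₆ * A₆ = tser ^ 3 • 1 →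
      Z₆ * (Z₃ * Z₀) * (A₀ * A₃ * A₆) = tser ^ 9 • 1 := by
    intro A₀ A₃ A₆ h₀ h₃ h₆
    calc _ = Z₆ * (Z₃ * (Z₀ * A₀) * A₃) * A₆ := by simp only [mul_assoc]
      _ = _ := by
        simp only [h₀, h₃, h₆, mul_smul_comm, smul_mul_assoc, mul_one, smul_smul, ← pow_add]
  have e := key _ _ _ e₀ e₃ e₆
  rw [hc] at e
  simp only [smul_mul_assoc, mul_smul_comm, smul_smul, one_mul] at e
  have e' : tser ^ 9 • (U i * U (i + 3) * U (i + 6)) =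
      tser ^ 9 • (1 : Matrix (Fin 3) (Fin 3) Rser) := by
    rw [← e]
    congr 1
    ring
  exact smul_right_injective _ (pow_ne_zero 9 tser_ne_zero) e'

theorem CMMod.triple_eq (U V : Matrix (Fin 3) (Fin 3) Rser) (i : ZMod 9)
    (h : M.Y (i + 1) * M.Y (i + 2) * M.Y (i + 3) = tser • U) (hUV : U * V = 1) :
    M.X (i + 3) * M.X (i + 2) * M.X (i + 1) = tser ^ 2 • V := by
  have e := congrArg (· * V) (M.triple_mul_triple i)
  simp only [h, mul_smul_comm, smul_mul_assoc, one_mul, mul_assoc, hUV, mul_one] at e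
  refine smul_right_injective _ tser_ne_zero ?_
  simp only [mul_assoc]
  rw [e, smul_smul]
  congr 1
  ring

/-- A self-extension twisting each flag by an arbitrary constant endomorphism. -/
theorem exists_ses_twisting_flags (S : Finset (ZMod 9)) (o : ZMod 9) (ho : o ∈ S)
    (hS₃ : ∀ i ∈ S, i + 3 ∈ S) (hS₁ : ∀ i ∈ S, i + 1 ∉ S) (hS₂ : ∀ i ∈ S, i + 2 ∉ S)
    (U V : ZMod 9 → Matrix (Fin 3) (Fin 3) Rser)
    (hU : ∀ i ∈ S, M.Y (i + 1) * M.Y (i + 2) * M.Y (i + 3) = tser • U i)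
    (hUV : ∀ i ∈ S, U i * V i = 1) (D : ZMod 9 → Matrix (Fin 3) (Fin 3) Rser) :
    ∃ (sE : ℕ) (E : CMMod 3 9 sE) (T : CMses M E M), T.Splits →
      ∃ H : ZMod 9 → Matrix (Fin 3) (Fin 3) Rser, ∀ i ∈ S,
        (D i + H i) * M.Y (i + 1) = M.Y (i + 1) * H (i + 1) ∧
        H (i + 1) * M.Y (i + 2) = M.Y (i + 2) * H (i + 2) ∧ U i * H (i + 3) = H i * U i := by
  have hZ : ∀ i ∈ S, M.X (i + 3) * M.X (i + 2) * M.X (i + 1) = tser ^ 2 • V i :=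
    fun i hi => CMMod.triple_eq _ _ i (hU i hi) (hUV i hi)
  let β : ZMod 9 → Matrix (Fin 3) (Fin 3) Rser := fun i => if i ∈ S then D i else 0
  let α : ZMod 9 → Matrix (Fin 3) (Fin 3) Rser :=
    fun i => if i ∈ S then V (i - 3) * D (i - 3) * U (i - 3) else 0
  have β₀ : ∀ i ∈ S, β i = D i := fun i hi => if_pos hi
  have β₁ : ∀ i ∈ S, β (i + 1) = 0 := fun i hi => if_neg (hS₁ i hi)
  have β₂ : ∀ i ∈ S, β (i + 2) = 0 := fun i hi => if_neg (hS₂ i hi)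
  have α₁ : ∀ i ∈ S, α (i + 1) = 0 := fun i hi => if_neg (hS₁ i hi)
  have α₂ : ∀ i ∈ S, α (i + 2) = 0 := fun i hi => if_neg (hS₂ i hi)
  have α₃ : ∀ i ∈ S, α (i + 3) = V i * D i * U i := fun i hi => by
    simp only [α, if_pos (hS₃ i hi), add_sub_cancel_right]
  have s₁ : ∀ i : ZMod 9, i + 1 - 1 = i := by decide
  have s₂ : ∀ i : ZMod 9, i + 2 - 1 = i + 1 := by decide
  have s₃ : ∀ i : ZMod 9, i + 3 - 1 = i + 2 := by decide
  let P : ZMod 9 → Matrix (Fin 3) (Fin 3) Rser := fun i => α i * M.X i - M.X i * β (i - 1)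
  let Q : ZMod 9 → Matrix (Fin 3) (Fin 3) Rser := fun i => β (i - 1) * M.Y i - M.Y i * α i
  let F : ZMod 9 → Matrix (Fin 3 ⊕ Fin 3) (Fin 3 ⊕ Fin 3) Rser :=
    fun i => Matrix.fromBlocks (M.X i) (P i) 0 (M.X i)
  let G : ZMod 9 → Matrix (Fin 3 ⊕ Fin 3) (Fin 3 ⊕ Fin 3) Rser :=
    fun i => Matrix.fromBlocks (M.Y i) (Q i) 0 (M.Y i)
  have hPQ : ∀ i, M.X i * Q i + P i * M.Y i = 0 := fun i => by
    have e₁ : M.X i * (M.Y i * α i) = tser • α i := by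
      rw [← mul_assoc, M.hXY, smul_mul_assoc, one_mul]
    simp only [P, Q, mul_sub, sub_mul, mul_assoc, M.hXY, mul_smul_comm, mul_one, e₁]
    abel
  have hQP : ∀ i, M.Y i * P i + Q i * M.X i = 0 := fun i => by
    have e₁ : M.Y i * (M.X i * β (i - 1)) = tser • β (i - 1) := by
      rw [← mul_assoc, M.hYX, smul_mul_assoc, one_mul]
    simp only [P, Q, mul_sub, sub_mul, mul_assoc, M.hYX, mul_smul_comm, mul_one, e₁]
    abel
  have hFG : ∀ i, F i * G i = tser • 1 := fun i => by
    simp only [F, G, Matrix.fromBlocks_multiply, hPQ, M.hXY, mul_zero, zero_mul, add_zero,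
      zero_add]
    rw [← Matrix.fromBlocks_one, Matrix.fromBlocks_smul, smul_zero]
  have hF : ∀ i ∈ S, F (i + 3) * F (i + 2) * F (i + 1) =
      Matrix.fromBlocks (M.X (i + 3) * M.X (i + 2) * M.X (i + 1)) 0 0
        (M.X (i + 3) * M.X (i + 2) * M.X (i + 1)) := fun i hi => by
    have p₁ : P (i + 1) = -(M.X (i + 1) * D i) := by simp [P, s₁, α₁ i hi, β₀ i hi]
    have p₂ : P (i + 2) = 0 := by simp [P, s₂, α₂ i hi, β₁ i hi]
    have p₃ : P (i + 3) = V i * D i * U i * M.X (i + 3) := by simp [P, s₃, α₃ i hi, β₂ i hi]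
    simp only [F, Matrix.fromBlocks_multiply, p₁, p₂, p₃, mul_zero, zero_mul, add_zero, zero_add]
    congr 1
    calc _ = V i * D i * U i * (M.X (i + 3) * M.X (i + 2) * M.X (i + 1)) -
          M.X (i + 3) * M.X (i + 2) * M.X (i + 1) * D i := by
            simp only [mul_neg, mul_assoc]
            abel
      _ = 0 := by
        rw [hZ i hi, mul_smul_comm, mul_assoc _ (U i), hUV i hi, mul_one, smul_mul_assoc, sub_self]
  have ho₆ : o + 6 ∈ S := by
    have := hS₃ _ (hS₃ o ho)
    rwa [add_assoc, show (3 : ZMod 9) + 3 = 6 from rfl] at this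
  have hFo : cyclicProd F o = tser ^ (9 - 3) • (1 : Matrix (Fin 3 ⊕ Fin 3) (Fin 3 ⊕ Fin 3) Rser) := by
    have hc := M.hcyc o
    rw [cycProd_eq_cyclicProd, cyclicProd_nine] at hc
    rw [cyclicProd_nine, hF _ ho₆, hF _ (hS₃ o ho), hF o ho, Matrix.fromBlocks_multiply,
      Matrix.fromBlocks_multiply]
    simp only [mul_zero, zero_mul, add_zero, zero_add, hc]
    rw [← Matrix.fromBlocks_one, Matrix.fromBlocks_smul, smul_zero]
  obtain ⟨sE, E, T, hT⟩ := exists_ses_of_deformation M P Q hPQ hQP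
    (cyclicProd_eq_smul_one hFG _ o hFo)
  refine ⟨sE, E, T, fun h => ?_⟩
  obtain ⟨H, hH⟩ := hT h
  refine ⟨H, fun i hi => ?_⟩
  have e₁ : (D i + H i) * M.Y (i + 1) = M.Y (i + 1) * H (i + 1) := by
    simpa [Q, s₁, β₀ i hi, α₁ i hi, add_mul] using hH (i + 1)
  have e₂ : H (i + 1) * M.Y (i + 2) = M.Y (i + 2) * H (i + 2) := by
    simpa [Q, s₂, β₁ i hi, α₂ i hi] using hH (i + 2)
  have e₃ : H (i + 2) * M.Y (i + 3) = M.Y (i + 3) * (V i * D i * U i + H (i + 3)) := by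
    have := hH (i + 3)
    simp only [Q, s₃, β₂ i hi, α₃ i hi, zero_mul, zero_sub] at this
    rw [mul_add, ← this, add_neg_cancel_left]
  refine ⟨e₁, e₂, ?_⟩
  have e : (D i + H i) * (M.Y (i + 1) * M.Y (i + 2) * M.Y (i + 3)) =
      (M.Y (i + 1) * M.Y (i + 2) * M.Y (i + 3)) * (V i * D i * U i + H (i + 3)) := by
    rw [← mul_assoc, ← mul_assoc, e₁, mul_assoc (M.Y (i + 1)), e₂]
    simp only [mul_assoc] at e₃ ⊢
    rw [e₃]
  rw [hU i hi, mul_smul_comm, smul_mul_assoc] at e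
  have e' := smul_right_injective _ tser_ne_zero e
  simp only [mul_add, add_mul, ← mul_assoc, hUV i hi, one_mul] at e'
  exact (add_left_cancel e').symm

theorem exists_not_splits (S : Finset (ZMod 9)) (o : ZMod 9) (ho : o ∈ S)
    (hS₃ : ∀ i ∈ S, i + 3 ∈ S) (hS₁ : ∀ i ∈ S, i + 1 ∉ S) (hS₂ : ∀ i ∈ S, i + 2 ∉ S)
    (hnull : ∀ i, nullity M i ≤ 1)
    (hU : ∀ i ∈ S, ∃ U, M.Y (i + 1) * M.Y (i + 2) * M.Y (i + 3) = tser • U) :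
    ∃ (sE : ℕ) (E : CMMod 3 9 sE) (T : CMses M E M), ¬ T.Splits := by
  choose! U hU using hU
  have s₆ : ∀ i : ZMod 9, i + 3 + 3 = i + 6 := by decide
  have s₉ : ∀ i : ZMod 9, i + 3 + 6 = i := by decide
  have hS₆ : ∀ i ∈ S, i + 6 ∈ S := fun i hi => s₆ i ▸ hS₃ _ (hS₃ i hi)
  have hUUU : ∀ i ∈ S, U i * U (i + 3) * U (i + 6) = 1 := fun i hi =>
    CMMod.mul_mul_eq_one U i (hU i hi) (hU _ (hS₃ i hi)) (hU _ (hS₆ i hi))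
  let V : ZMod 9 → Matrix (Fin 3) (Fin 3) Rser := fun i => U (i + 3) * U (i + 6)
  have hUV : ∀ i ∈ S, U i * V i = 1 := fun i hi => by
    rw [← hUUU i hi, mul_assoc]
  have hVU : ∀ i ∈ S, V i * U i = 1 := fun i hi => by
    have := hUUU _ (hS₃ i hi)
    rwa [s₆, s₉] at this
  have hl : ∀ i ∈ S, ∃ l : Matrix (Fin 3) (Fin 3) ℂ →ₗ[ℂ] ℂ × ℂ × ℂ, Function.Surjective l ∧
      ∀ A B C, A * red (M.Y (i + 1)) = red (M.Y (i + 1)) * B →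
        B * red (M.Y (i + 2)) = red (M.Y (i + 2)) * C → l A = 0 := fun i hi => by
    refine exists_matrix_flag_functional _ _ (red (M.Y (i + 3))) (hnull _) (hnull _) (hnull _) ?_
    rw [← red_mul, ← red_mul, hU i hi]
    ext
    simp [red, tser]
  choose! l hl hl' using hl
  have hl1 : ∀ i ∈ S, l i 1 = 0 := fun i hi => hl' i hi 1 1 1 (by simp) (by simp)
  let conj (A B : Matrix (Fin 3) (Fin 3) ℂ) := LinearMap.mulLeft ℂ A ∘ₗ LinearMap.mulRight ℂ B
  let u : ZMod 9 → Matrix (Fin 3) (Fin 3) ℂ := fun i => red (U i)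
  let v : ZMod 9 → Matrix (Fin 3) (Fin 3) ℂ := fun i => red (V i)
  have hvu : ∀ i ∈ S, v i * u i = 1 := fun i hi => by
    rw [← red_mul, hVU i hi, red_one]
  let Θ : Matrix (Fin 3) (Fin 3) ℂ →ₗ[ℂ] (ℂ × ℂ × ℂ) × (ℂ × ℂ × ℂ) × (ℂ × ℂ × ℂ) :=
    (l o).prod ((l (o + 3) ∘ₗ conj (v o) (u o)).prod
      (l (o + 6) ∘ₗ conj (v (o + 3)) (u (o + 3)) ∘ₗ conj (v o) (u o)))
  have hΘ1 : Θ 1 = 0 := by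
    simp [Θ, conj, hvu o ho, hvu _ (hS₃ o ho), hl1 o ho, hl1 _ (hS₃ o ho), hl1 _ (hS₆ o ho)]
  have hsurj : ¬ Function.Surjective Θ := by
    rw [← LinearMap.injective_iff_surjective_of_finrank_eq_finrank
      (by simp [Module.finrank_matrix])]
    intro hinj
    exact one_ne_zero (hinj (hΘ1.trans (map_zero Θ).symm))
  simp only [Function.Surjective, not_forall] at hsurj
  obtain ⟨⟨c₀, c₃, c₆⟩, hc⟩ := hsurj
  obtain ⟨d₀, hd₀⟩ := hl o ho (-c₀)
  obtain ⟨d₃, hd₃⟩ := hl _ (hS₃ o ho) (-c₃)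
  obtain ⟨d₆, hd₆⟩ := hl _ (hS₆ o ho) (-c₆)
  let D : ZMod 9 → Matrix (Fin 3) (Fin 3) Rser := fun i =>
    lift (if i = o then d₀ else if i = o + 3 then d₃ else d₆)
  have n₃ : ∀ o : ZMod 9, o + 3 ≠ o := by decide
  have n₆ : ∀ o : ZMod 9, o + 6 ≠ o ∧ o + 6 ≠ o + 3 := by decide
  obtain ⟨sE, E, T, hT⟩ := exists_ses_twisting_flags S o ho hS₃ hS₁ hS₂ U V hU hUV D
  refine ⟨sE, E, T, fun h => hc ?_⟩
  obtain ⟨H, hH⟩ := hT h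
  have hlH : ∀ i ∈ S, l i (red (D i)) + l i (red (H i)) = 0 := fun i hi => by
    have e₁ := congrArg red (hH i hi).1
    have e₂ := congrArg red (hH i hi).2.1
    simp only [red_mul] at e₁ e₂
    rw [← map_add, ← red_add]
    exact hl' i hi _ _ _ e₁ e₂
  have hHu : ∀ i ∈ S, v i * (red (H i) * u i) = red (H (i + 3)) := fun i hi => by
    rw [← red_mul, ← (hH i hi).2.2, red_mul, ← mul_assoc, hvu i hi, one_mul]
  have t₀ := hlH o ho
  have t₃ := hlH _ (hS₃ o ho)
  have t₆ := hlH _ (hS₆ o ho)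
  simp only [D, red_lift, if_true, if_neg (n₃ o), if_neg (n₆ o).1, if_neg (n₆ o).2, hd₀, hd₃,
    hd₆, neg_add_eq_zero] at t₀ t₃ t₆
  refine ⟨red (H o), ?_⟩
  have w₆ := hHu _ (hS₃ o ho)
  rw [s₆] at w₆
  simp [Θ, conj, hHu o ho, w₆, ← t₀, ← t₃, ← t₆]

end SelfExtension

/-- An indecomposable module in `CM(B_{3,9})` whose profile is a cyclic
permutation of `369|258|147` is not rigid: some self-extension does not split. -/
theorem profile_369_258_147_not_rigid (M : CMMod 3 9 3) (hind : Indecomposable M)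
    (hfil : HasFiltration M [({3, 6, 9} : Finset (ZMod 9)), {2, 5, 8}, {1, 4, 7}] ∨
            HasFiltration M [({2, 5, 8} : Finset (ZMod 9)), {1, 4, 7}, {3, 6, 9}] ∨
            HasFiltration M [({1, 4, 7} : Finset (ZMod 9)), {3, 6, 9}, {2, 5, 8}]) :
    ∃ (sE : ℕ) (E : CMMod 3 9 sE) (S : CMses M E M), ¬ S.Splits := by
  rcases hfil with h | h | h
  · refine exists_not_splits {0, 3, 6} 0 (by decide) (by decide) (by decide) (by decide)
      (fun i => (h.nullity_le i).trans (by revert i; decide)) fun i hi => ?_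
    exact h.exists_mul_eq i (by revert i; decide) (by revert i; decide) (by revert i; decide)
  · refine exists_not_splits {2, 5, 8} 2 (by decide) (by decide) (by decide) (by decide)
      (fun i => (h.nullity_le i).trans (by revert i; decide)) fun i hi => ?_
    exact h.exists_mul_eq i (by revert i; decide) (by revert i; decide) (by revert i; decide)
  · refine exists_not_splits {1, 4, 7} 1 (by decide) (by decide) (by decide) (by decide)
      (fun i => (h.nullity_le i).trans (by revert i; decide)) fun i hi => ?_
    exact h.exists_mul_eq i (by revert i; decide) (by revert i; decide) (by revert i; decide)

end GCC
end
end

section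
/- Let n ≥ 6 and let I ⊆ ℤ/n be a 3-element subset such that i+1 ∉ I for every i ∈ I (i.e. the rank-1 module L_I has three peaks). Set X = {i+1 : i ∈ I} and Y = {i+2 : i ∈ I} (computed modulo n). Then there exist a rank-3 module M and a rank-2 module N in CM(B_{3,n}) such that N admits the filtration L_X | L_Y and there is an almost split sequence 0 → L_I → M → N → 0. Moreover, if M is indecomposable, then M admits the filtration L_X | L_I | L_Y. -/
open scoped Classical

noncomputable section

namespace GCC

/-- `f : X → B` is a split epimorphism: `f ∘ g = id_B` for some `g : B → X`. -/
def IsSplitEpi {k n sX sB : ℕ} {Xm : CMMod k n sX} {B : CMMod k n sB} (f : CMHom Xm B) : Prop :=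
  ∃ g : CMHom B Xm, ∀ i, f.F i * g.F i = 1

/-- `S : 0 → A → E → B → 0` is an almost split (Auslander–Reiten) sequence:
it does not split, `A` and `B` are indecomposable, and every morphism to `B`
which is not a split epimorphism factors through `E`. -/
def AlmostSplit {k n sA sE sB : ℕ} {A : CMMod k n sA} {E : CMMod k n sE} {B : CMMod k n sB}
    (S : CMses A E B) : Prop :=
  ¬ S.Splits ∧ Indecomposable A ∧ Indecomposable B ∧
  ∀ (sX : ℕ) (Xm : CMMod k n sX) (f : CMHom Xm B), ¬ IsSplitEpi f →
    ∃ g : CMHom Xm E, ∀ i, S.quo.F i * g.F i = f.F i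

section General

theorem zmod_pred_induction {n : ℕ} [NeZero n] {p : ZMod n → Prop} (a : ZMod n) (ha : p a)
    (h : ∀ i, p i → p (i - 1)) (i : ZMod n) : p i := by
  have key : ∀ m : ℕ, p (a - m) := by
    intro m
    induction m with
    | zero => simpa using ha
    | succ m ih =>
      have := h _ ih
      rwa [sub_sub, ← Nat.cast_succ] at this
  simpa using key (a - i).val

theorem zmod_succ_induction {n : ℕ} [NeZero n] {p : ZMod n → Prop} (a : ZMod n) (ha : p a)
    (h : ∀ i, p (i - 1) → p i) (i : ZMod n) : p i := by
  have key : ∀ m : ℕ, p (a + m) := by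
    intro m
    induction m with
    | zero => simpa using ha
    | succ m ih =>
      refine h _ ?_
      rwa [Nat.cast_succ, ← add_assoc, add_sub_cancel_right]
  simpa using key (i - a).val

theorem zmod_const {n : ℕ} [NeZero n] {α : Type*} {f : ZMod n → α}
    (h : ∀ i, f i = f (i - 1)) (i j : ZMod n) : f i = f j :=
  zmod_succ_induction (p := fun i => f i = f j) j rfl (fun l hl => (h l).trans hl) i

theorem zmod_val_sub_one {n : ℕ} (hn : 2 ≤ n) (i : ZMod n) :
    (i.val = 0 ∧ (i - 1).val = n - 1) ∨ (i.val ≠ 0 ∧ (i - 1).val + 1 = i.val) := by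
  have : NeZero n := ⟨by omega⟩
  have : Fact (1 < n) := ⟨by omega⟩
  by_cases h : i = 0
  · left
    subst h
    refine ⟨ZMod.val_zero, ?_⟩
    rw [zero_sub, ZMod.neg_val, if_neg one_ne_zero, ZMod.val_one]
  · right
    have h0 : i.val ≠ 0 := fun h' => h ((ZMod.val_eq_zero i).1 h')
    refine ⟨h0, ?_⟩
    rw [ZMod.val_sub, ZMod.val_one]
    · omega
    · rw [ZMod.val_one]; omega

/-- A linear functional that is integral on the kernel of a linear map into a vector space over the
fraction field becomes integral after adding a functional which factors through that map. -/
theorem exists_dual_add_mem_range {R K F V : Type*} [CommRing R] [IsDomain R]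
    [IsPrincipalIdealRing R] [Field K] [Algebra R K] [IsFractionRing R K]
    [AddCommGroup F] [Module R F] [Module.Finite R F]
    [AddCommGroup V] [Module R V] [Module K V] [IsScalarTower R K V]
    (σ : F →ₗ[R] V) (l : F →ₗ[R] K)
    (h : ∀ z, σ z = 0 → l z ∈ (algebraMap R K).range) :
    ∃ ψ : Module.Dual K V, ∀ z, l z + ψ (σ z) ∈ (algebraMap R K).range := by
  have : Module.IsTorsionFree R K := inferInstance
  have : Module.IsTorsionFree R V := Module.IsTorsionFree.trans_faithfulSMul R K V
  have : Module.Finite R (LinearMap.range σ) := inferInstance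
  have : Module.Free R (LinearMap.range σ) := inferInstance
  let b := Module.Free.chooseBasis R (LinearMap.range σ)
  have hb : LinearIndependent R (fun j => (b j : V)) :=
    b.linearIndependent.map' (LinearMap.range σ).subtype (Submodule.ker_subtype _)
  have hbK : LinearIndependent K (fun j => (b j : V)) :=
    (LinearIndependent.iff_fractionRing R K).1 hb
  choose z hz using fun j => (b j).2
  obtain ⟨ψ, hψ⟩ : ∃ ψ : Module.Dual K V, ∀ j, ψ (b j) = -l (z j) := by
    obtain ⟨ψ, hψ⟩ := ((Module.Basis.span hbK).constr K fun j => -l (z j)).exists_extend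
    refine ⟨ψ, fun j => ?_⟩
    have := LinearMap.congr_fun hψ (Module.Basis.span hbK j)
    rwa [Module.Basis.constr_basis, LinearMap.comp_apply, Submodule.subtype_apply,
      Module.Basis.span_apply] at this
  refine ⟨ψ, fun w => ?_⟩
  have hw := b.sum_repr ⟨σ w, w, rfl⟩
  set c := b.repr ⟨σ w, w, rfl⟩
  have hw' : σ w = ∑ j, c j • (b j : V) := by
    have := congrArg (LinearMap.range σ).subtype hw
    simpa using this.symm
  have hker : σ (w - ∑ j, c j • z j) = 0 := by
    simp [hw', hz]
  have e : l w + ψ (σ w) = l (w - ∑ j, c j • z j) := by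
    rw [hw', map_sub, map_sum, map_sum, sub_eq_add_neg, ← Finset.sum_neg_distrib]
    congr 1
    refine Finset.sum_congr rfl fun j _ => ?_
    rw [← algebraMap_smul K (c j) (b j : V), map_smul, hψ, map_smul, algebraMap_smul, smul_neg]
  rw [e]
  exact h _ hker

end General

section Ring

theorem tser_dvd_iff (f : Rser) : tser ∣ f ↔ PowerSeries.constantCoeff f = 0 :=
  PowerSeries.X_dvd_iff

theorem constantCoeff_tser : PowerSeries.constantCoeff tser = 0 := PowerSeries.constantCoeff_X

/-- The entry of `X i` in the rank-1 module `L_J`. -/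
def xVal {n : ℕ} (J : Finset (ZMod n)) (i : ZMod n) : Rser := if i ∈ J then 1 else tser

/-- The entry of `Y i` in the rank-1 module `L_J`. -/
def yVal {n : ℕ} (J : Finset (ZMod n)) (i : ZMod n) : Rser := if i ∈ J then tser else 1

theorem xVal_mul_yVal {n : ℕ} (J : Finset (ZMod n)) (i : ZMod n) :
    xVal J i * yVal J i = tser := by
  unfold xVal yVal; split_ifs <;> simp

theorem yVal_mul_xVal {n : ℕ} (J : Finset (ZMod n)) (i : ZMod n) :
    yVal J i * xVal J i = tser := by
  rw [mul_comm, xVal_mul_yVal]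

theorem xVal_ne_zero {n : ℕ} (J : Finset (ZMod n)) (i : ZMod n) : xVal J i ≠ 0 := by
  unfold xVal; split_ifs
  exacts [one_ne_zero, tser_ne_zero]

theorem prod_xVal {n : ℕ} [NeZero n] (J : Finset (ZMod n)) (i : ZMod n) :
    ∏ j ∈ Finset.range n, xVal J (i - j) = tser ^ (n - J.card) := by
  have h1 : ∏ j ∈ Finset.range n, xVal J (i - j) = ∏ l : ZMod n, xVal J l := by
    refine Finset.prod_bij' (fun j _ => i - (j : ZMod n)) (fun l _ => (i - l).val) ?_ ?_ ?_ ?_ ?_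
    · simp
    · intro l _; exact Finset.mem_range.2 (ZMod.val_lt _)
    · intro j hj
      simp [ZMod.val_natCast, Nat.mod_eq_of_lt (Finset.mem_range.1 hj)]
    · simp
    · simp
  rw [h1]
  unfold xVal
  rw [Finset.prod_ite, Finset.prod_const_one, one_mul, Finset.prod_const]
  congr 1
  rw [Finset.filter_not, Finset.card_sdiff]
  simp [ZMod.card]

end Ring

section Modules

theorem cycProd_eq {n s : ℕ} (X : ZMod n → Matrix (Fin s) (Fin s) Rser) (i : ZMod n) :
    cycProd X i = ((List.range n).map fun j : ℕ => X (i - (j : ZMod n))).prod := by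
  simp only [cycProd, List.bind_eq_flatMap, List.pure_def, ← List.map_eq_flatMap, List.map_map,
    Function.comp_def]

theorem intertwine_prod {n s s' : ℕ} {X : ZMod n → Matrix (Fin s) (Fin s) Rser}
    {X' : ZMod n → Matrix (Fin s') (Fin s') Rser} {F : ZMod n → Matrix (Fin s') (Fin s) Rser}
    (h : ∀ i, F i * X i = X' i * F (i - 1)) (i : ZMod n) (m : ℕ) :
    F i * ((List.range m).map fun j : ℕ => X (i - (j : ZMod n))).prod =
      ((List.range m).map fun j : ℕ => X' (i - (j : ZMod n))).prod * F (i - m) := by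
  induction m with
  | zero => simp
  | succ m ih =>
    rw [List.range_succ, List.map_append, List.map_append, List.prod_append, List.prod_append,
      ← Matrix.mul_assoc, ih]
    simp only [List.map_cons, List.map_nil, List.prod_cons, List.prod_nil, mul_one]
    rw [Matrix.mul_assoc, h, Matrix.mul_assoc, Nat.cast_succ, sub_sub]

theorem intertwine_cycProd {n s s' : ℕ} {X : ZMod n → Matrix (Fin s) (Fin s) Rser}
    {X' : ZMod n → Matrix (Fin s') (Fin s') Rser} {F : ZMod n → Matrix (Fin s') (Fin s) Rser}
    (h : ∀ i, F i * X i = X' i * F (i - 1)) (i : ZMod n) :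
    F i * cycProd X i = cycProd X' i * F i := by
  simpa [cycProd_eq] using intertwine_prod h i n

theorem cycProd_diagonal {n s : ℕ} (d : ZMod n → Fin s → Rser) (i : ZMod n) :
    cycProd (fun i => Matrix.diagonal (d i)) i =
      Matrix.diagonal fun a => ∏ j ∈ Finset.range n, d (i - j) a := by
  have key : ∀ m : ℕ, ((List.range m).map fun j : ℕ =>
      (Matrix.diagonal (d (i - (j : ZMod n))) : Matrix (Fin s) (Fin s) Rser)).prod =
        Matrix.diagonal fun a => ∏ j ∈ Finset.range m, d (i - j) a := by
    intro m
    induction m with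
    | zero => simp
    | succ m ih =>
      rw [List.range_succ, List.map_append, List.prod_append, ih]
      simp [Matrix.diagonal_mul_diagonal, Finset.prod_range_succ]
  rw [cycProd_eq, key]

/-- The module built from matrices `X`, `Y` which become a direct sum of rank-1 modules after
inverting `t`. -/
def CMMod.ofDiagonalization {k n s : ℕ} [NeZero n] (J : Fin s → Finset (ZMod n))
    (hJ : ∀ a, (J a).card = k) (X Y : ZMod n → Matrix (Fin s) (Fin s) Rser)
    (hXY : ∀ i, X i * Y i = tser • (1 : Matrix (Fin s) (Fin s) Rser))
    (hYX : ∀ i, Y i * X i = tser • (1 : Matrix (Fin s) (Fin s) Rser))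
    (G G' : ZMod n → Matrix (Fin s) (Fin s) Rser)
    (hG : ∀ i, G i * Matrix.diagonal (fun a => xVal (J a) i) = X i * G (i - 1))
    (hG' : ∀ i, G i * G' i = tser ^ 2 • (1 : Matrix (Fin s) (Fin s) Rser)) : CMMod k n s where
  X := X
  Y := Y
  hXY := hXY
  hYX := hYX
  hcyc i := by
    have h := intertwine_cycProd hG i
    rw [cycProd_diagonal] at h
    simp only [prod_xVal, hJ] at h
    have h2 := congrArg (· * G' i) h
    simp only [Matrix.mul_assoc, hG'] at h2
    have h3 : Matrix.diagonal (fun _ : Fin s => tser ^ (n - k)) =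
      (tser ^ (n - k)) • (1 : Matrix (Fin s) (Fin s) Rser) := by
      rw [Matrix.smul_one_eq_diagonal]
    rw [h3] at h2
    simp only [Matrix.smul_mul, Matrix.mul_smul, Matrix.one_mul, Matrix.mul_one, hG'] at h2
    rw [smul_comm] at h2
    exact (smul_right_injective _ (pow_ne_zero 2 tser_ne_zero) h2).symm

/-- The direct sum of the rank-1 modules `L_{J a}`. -/
def sumRankOne {k n s : ℕ} [NeZero n] (J : Fin s → Finset (ZMod n))
    (hJ : ∀ a, (J a).card = k) : CMMod k n s :=
  CMMod.ofDiagonalization J hJ (fun i => Matrix.diagonal fun a => xVal (J a) i)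
    (fun i => Matrix.diagonal fun a => yVal (J a) i)
    (fun i => by simp [Matrix.diagonal_mul_diagonal, xVal_mul_yVal, Matrix.smul_one_eq_diagonal])
    (fun i => by simp [Matrix.diagonal_mul_diagonal, yVal_mul_xVal, Matrix.smul_one_eq_diagonal])
    (fun _ => 1) (fun _ => tser ^ 2 • 1) (fun i => by simp) (fun i => by simp)

theorem isRankOne_sumRankOne {k n : ℕ} [NeZero n] (J : Finset (ZMod n)) (hJ : J.card = k) :
    IsRankOne J (sumRankOne (fun _ : Fin 1 => J) fun _ => hJ) := by
  constructor <;> intro i <;> ext a b <;> fin_cases a <;> fin_cases b <;>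
    simp [sumRankOne, CMMod.ofDiagonalization, xVal, yVal] <;> split_ifs <;> simp

/-- A family of matrices commuting with the maps `X` is a morphism. -/
def CMHom.ofX {k n s s' : ℕ} {M : CMMod k n s} {M' : CMMod k n s'}
    (F : ZMod n → Matrix (Fin s') (Fin s) Rser)
    (hX : ∀ i, F i * M.X i = M'.X i * F (i - 1)) : CMHom M M' where
  F := F
  hX := hX
  hY i := by
    have h : M'.Y i * (F i * M.X i) * M.Y i = M'.Y i * (M'.X i * F (i - 1)) * M.Y i := by rw [hX]
    rw [← Matrix.mul_assoc (M'.Y i) (M'.X i), M'.hYX, Matrix.mul_assoc, Matrix.mul_assoc, M.hXY]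
      at h
    simp only [Matrix.smul_mul, Matrix.mul_smul, Matrix.one_mul, Matrix.mul_one] at h
    exact (smul_right_injective _ tser_ne_zero h).symm

/-- Composition of morphisms. -/
def CMHom.comp {k n s s' s'' : ℕ} {M : CMMod k n s} {M' : CMMod k n s'} {M'' : CMMod k n s''}
    (g : CMHom M' M'') (f : CMHom M M') : CMHom M M'' :=
  CMHom.ofX (fun i => g.F i * f.F i) fun i => by
    rw [Matrix.mul_assoc, f.hX, ← Matrix.mul_assoc, g.hX, Matrix.mul_assoc]

/-- Morphisms that are split at each vertex form a short exact sequence. -/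
def CMses.ofSplitAtVertices {k n sA sE sB : ℕ} {A : CMMod k n sA} {E : CMMod k n sE}
    {B : CMMod k n sB} (e : CMHom A E) (q : CMHom E B)
    (r : Matrix (Fin sA) (Fin sE) Rser) (s : Matrix (Fin sE) (Fin sB) Rser)
    (hre : ∀ i, r * e.F i = 1) (hqs : ∀ i, q.F i * s = 1) (hqe : ∀ i, q.F i * e.F i = 0)
    (h1 : ∀ i, e.F i * r + s * q.F i = 1) : CMses A E B where
  emb := e
  quo := q
  inj i := by
    refine Function.LeftInverse.injective (g := r.mulVecLin) fun v => ?_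
    simp [hre]
  surj i := by
    refine Function.RightInverse.surjective (g := s.mulVecLin) fun v => ?_
    simp [hqs]
  exactness i := by
    ext v
    simp only [LinearMap.mem_range, LinearMap.mem_ker, Matrix.mulVecLin_apply]
    constructor
    · rintro ⟨w, rfl⟩
      simp [hqe]
    · intro hv
      refine ⟨r.mulVec v, ?_⟩
      have := congrArg (Matrix.mulVec · v) (h1 i)
      simpa [Matrix.add_mulVec, ← Matrix.mulVec_mulVec, hv] using this

end Modules

section Trivialization

/-- The fraction field of `ℂ⟦t⟧`. -/
abbrev Kser : Type := FractionRing Rser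

/-- The image of `t` in the fraction field. -/
def tK : Kser := algebraMap Rser Kser tser

theorem tK_ne_zero : tK ≠ 0 := by
  simpa [tK] using tser_ne_zero

/-- The composite `X_m ⋯ X_1`. -/
def partialProd {n s : ℕ} (X : ZMod n → Matrix (Fin s) (Fin s) Rser) (m : ℕ) :
    Matrix (Fin s) (Fin s) Rser :=
  ((List.range m).map fun j : ℕ => X ((m : ZMod n) - (j : ZMod n))).prod

theorem partialProd_succ {n s : ℕ} (X : ZMod n → Matrix (Fin s) (Fin s) Rser) (m : ℕ) :
    partialProd X (m + 1) = X ((m : ZMod n) + 1) * partialProd X m := by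
  unfold partialProd
  rw [List.range_succ_eq_map, List.map_cons, List.prod_cons, List.map_map]
  simp [Function.comp_def]

theorem partialProd_self {n s : ℕ} (X : ZMod n → Matrix (Fin s) (Fin s) Rser) :
    partialProd X n = cycProd X 0 := by
  simp [partialProd, cycProd_eq]

/-- After inverting `t`, every Cohen–Macaulay module is a sum of copies of any given rank-1
module. -/
theorem exists_trivialization {k n s : ℕ} [NeZero n] (Z : CMMod k n s) (I : Finset (ZMod n))
    (hI : I.card = k) :
    ∃ P Q : ZMod n → Matrix (Fin s) (Fin s) Kser,
      (∀ i, P i * Q i = 1) ∧ (∀ i, Q i * P i = 1) ∧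
      (∀ i, (Z.X i).map (algebraMap Rser Kser) * P (i - 1) =
        algebraMap Rser Kser (xVal I i) • P i) ∧
      (∀ i, Q i * (Z.X i).map (algebraMap Rser Kser) =
        algebraMap Rser Kser (xVal I i) • Q (i - 1)) := by
  let φ := algebraMap Rser Kser
  let c : ℕ → Rser := fun m => ∏ j ∈ Finset.range m, xVal I (j + 1)
  have hc : ∀ m, φ (c m) ≠ 0 := fun m => by
    simpa [φ, c, Finset.prod_eq_zero_iff] using fun j _ => xVal_ne_zero I _
  have hcn : c n = tser ^ (n - k) := by
    rw [← hI, ← prod_xVal I 0]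
    simp only [c]
    rw [← Finset.prod_range_reflect]
    refine Finset.prod_congr rfl fun j hj => ?_
    have hj' := Finset.mem_range.1 hj
    congr 1
    have : ((n - 1 - j : ℕ) : ZMod n) + 1 + j = 0 := by
      have h := congrArg (Nat.cast : ℕ → ZMod n) (show (n - 1 - j) + 1 + j = n by omega)
      simpa using h
    linear_combination this
  let U : ℕ → Matrix (Fin s) (Fin s) Kser := fun m => (φ (c m))⁻¹ • (partialProd Z.X m).map φ
  have hU0 : U 0 = 1 := by simp [U, c, partialProd]
  have hUn : U n = 1 := by
    simp only [U, partialProd_self, Z.hcyc, hcn]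
    have : ((tser ^ (n - k)) • (1 : Matrix (Fin s) (Fin s) Rser)).map φ =
        φ (tser ^ (n - k)) • (1 : Matrix (Fin s) (Fin s) Kser) := by
      ext a b
      simp [Matrix.one_apply, apply_ite φ]
    rw [this, smul_smul, inv_mul_cancel₀, one_smul]
    rw [← hcn]; exact hc n
  have hUs : ∀ m : ℕ, (Z.X ((m : ZMod n) + 1)).map φ * U m = φ (xVal I (m + 1)) • U (m + 1) := by
    intro m
    have hcs : c (m + 1) = c m * xVal I (m + 1) := Finset.prod_range_succ _ _
    have hx : φ (xVal I (m + 1)) ≠ 0 := by simpa [φ] using xVal_ne_zero I _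
    simp only [U, partialProd_succ, Matrix.map_mul, Matrix.mul_smul, smul_smul, hcs, map_mul]
    congr 1
    field_simp [hc m]
  have hP : ∀ i, (Z.X i).map φ * U (i - 1).val = φ (xVal I i) • U i.val := by
    intro i
    have h := hUs (i - 1).val
    rw [ZMod.natCast_zmod_val, sub_add_cancel] at h
    rw [h]
    congr 1
    by_cases hi : (i - 1).val + 1 = n
    · have : i = 0 := by
        have := congrArg (Nat.cast : ℕ → ZMod n) hi
        simpa using this
      rw [hi, hUn, this, ZMod.val_zero, hU0]
    · congr 1
      have h1 : (i - 1).val + 1 < n := lt_of_le_of_ne (ZMod.val_lt _) hi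
      have h2 := ZMod.val_natCast_of_lt h1
      rw [Nat.cast_succ, ZMod.natCast_zmod_val, sub_add_cancel] at h2
      exact h2.symm
  have hXu : ∀ i, IsUnit ((Z.X i).map φ) := by
    intro i
    rw [Matrix.isUnit_iff_isUnit_det]
    have h := congrArg (fun A => (A.map φ).det) (Z.hXY i)
    simp only [Matrix.map_mul, Matrix.det_mul] at h
    refine isUnit_of_mul_isUnit_left (y := ((Z.Y i).map φ).det) ?_
    rw [h, show (tser • (1 : Matrix (Fin s) (Fin s) Rser)).map φ =
        tK • (1 : Matrix (Fin s) (Fin s) Kser) by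
      ext a b; simp [Matrix.one_apply, apply_ite φ, φ, tK]]
    simp [tK_ne_zero]
  have hUu : ∀ m, IsUnit (U m) := by
    intro m
    induction m with
    | zero => rw [hU0]; exact isUnit_one
    | succ m ih =>
      have hx : φ (xVal I (m + 1)) ≠ 0 := by simpa [φ] using xVal_ne_zero I _
      have h := (hXu ((m : ZMod n) + 1)).mul ih
      rw [hUs] at h
      have := h.smul (Units.mk0 _ hx)⁻¹
      simpa [Units.smul_def, smul_smul, hx] using this
  choose u hu using fun m => (hUu m)
  have hPQ : ∀ i : ZMod n, U i.val * (u i.val)⁻¹.1 = 1 := fun i => by rw [← hu]; simp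
  have hQP : ∀ i : ZMod n, (u i.val)⁻¹.1 * U i.val = 1 := fun i => by rw [← hu]; simp
  refine ⟨fun i => U i.val, fun i => (u i.val)⁻¹.1, hPQ, hQP, hP, fun i => ?_⟩
  calc (u i.val)⁻¹.1 * (Z.X i).map φ
      = (u i.val)⁻¹.1 * ((Z.X i).map φ * U (i - 1).val) * (u (i - 1).val)⁻¹.1 := by
        rw [← Matrix.mul_assoc, Matrix.mul_assoc, hPQ, Matrix.mul_one]
    _ = _ := by
        rw [hP, Matrix.mul_smul, hQP, Matrix.smul_mul, Matrix.one_mul]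

end Trivialization

section Arcs

/-- A three-peak set `I = {a, b, c}` with functions `κ`, `μ` that are constant on the cyclic
intervals between consecutive elements of `I`, including the right endpoint. -/
structure ArcData (n : ℕ) (I : Finset (ZMod n)) where
  a : ZMod n
  b : ZMod n
  c : ZMod n
  κ : ZMod n → Rser
  μ : ZMod n → Rser
  mem_iff : ∀ i, i ∈ I ↔ i = a ∨ i = b ∨ i = c
  hκ : ∀ i, i - 1 ∉ I → κ i = κ (i - 1)
  hμ : ∀ i, i - 1 ∉ I → μ i = μ (i - 1)
  κa : κ a = 0
  κb : κ b = 1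
  κc : κ c = -1
  κa' : κ (a + 1) = 1
  κb' : κ (b + 1) = -1
  κc' : κ (c + 1) = 0
  μa : μ a = 1
  μb : μ b = 0
  μc : μ c = 0

theorem exists_val_lt_of_card_eq_three {n : ℕ} [NeZero n] {I : Finset (ZMod n)}
    (hI : I.card = 3) :
    ∃ a b c : ZMod n, a.val < b.val ∧ b.val < c.val ∧ ∀ i, i ∈ I ↔ i = a ∨ i = b ∨ i = c := by
  obtain ⟨x, y, z, hxy, hxz, hyz, rfl⟩ := Finset.card_eq_three.1 hI
  have h1 := (ZMod.val_injective n).ne hxy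
  have h2 := (ZMod.val_injective n).ne hxz
  have h3 := (ZMod.val_injective n).ne hyz
  simp only [Finset.mem_insert, Finset.mem_singleton]
  rcases h1.lt_or_gt with h1 | h1 <;> rcases h2.lt_or_gt with h2 | h2 <;>
    rcases h3.lt_or_gt with h3 | h3
  · exact ⟨x, y, z, h1, h3, fun i => by tauto⟩
  · exact ⟨x, z, y, h2, h3, fun i => by tauto⟩
  · omega
  · exact ⟨z, x, y, h2, h1, fun i => by tauto⟩
  · exact ⟨y, x, z, h1, h2, fun i => by tauto⟩
  · omega
  · exact ⟨y, z, x, h3, h2, fun i => by tauto⟩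
  · exact ⟨z, y, x, h3, h1, fun i => by tauto⟩

theorem nonempty_arcData {n : ℕ} (hn : 2 ≤ n) {I : Finset (ZMod n)} (hI : I.card = 3) :
    Nonempty (ArcData n I) := by
  have : NeZero n := ⟨by omega⟩
  obtain ⟨a, b, c, hab, hbc, hmem⟩ := exists_val_lt_of_card_eq_three hI
  have hc := ZMod.val_lt c
  have key : ∀ i : ZMod n, i - 1 ∉ I →
      (i.val = 0 ∧ (i - 1).val = n - 1 ∨ i.val ≠ 0 ∧ (i - 1).val + 1 = i.val) ∧
      (i - 1).val ≠ a.val ∧ (i - 1).val ≠ b.val ∧ (i - 1).val ≠ c.val := by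
    intro i hi
    rw [hmem] at hi
    push Not at hi
    exact ⟨zmod_val_sub_one hn i, (ZMod.val_injective n).ne hi.1,
      (ZMod.val_injective n).ne hi.2.1, (ZMod.val_injective n).ne hi.2.2⟩
  have ha' := zmod_val_sub_one hn (a + 1)
  have hb' := zmod_val_sub_one hn (b + 1)
  have hc' := zmod_val_sub_one hn (c + 1)
  rw [add_sub_cancel_right] at ha' hb' hc'
  refine ⟨⟨a, b, c,
    fun i => if i.val ≤ a.val ∨ c.val < i.val then 0 else if i.val ≤ b.val then 1 else -1,
    fun i => if i.val ≤ a.val ∨ c.val < i.val then 1 else 0, hmem, ?_, ?_, ?_, ?_, ?_, ?_, ?_, ?_,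
    ?_, ?_, ?_⟩⟩
  · intro i hi
    obtain ⟨h, h1, h2, h3⟩ := key i hi
    have hlt := ZMod.val_lt (i - 1)
    have e1 : (i.val ≤ a.val ∨ c.val < i.val) ↔
      ((i - 1).val ≤ a.val ∨ c.val < (i - 1).val) := by omega
    simp only [e1]
    split_ifs with h4 h5 h6 h6 <;> first | rfl | (exfalso; omega)
  · intro i hi
    obtain ⟨h, h1, h2, h3⟩ := key i hi
    have hlt := ZMod.val_lt (i - 1)
    have e1 : (i.val ≤ a.val ∨ c.val < i.val) ↔
      ((i - 1).val ≤ a.val ∨ c.val < (i - 1).val) := by omega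
    simp only [e1]
  all_goals
    split_ifs <;> first | rfl | (exfalso; omega)

end Arcs

section Construction

variable {n : ℕ} {I : Finset (ZMod n)}

/-- The translate `I + m`. -/
def shift (I : Finset (ZMod n)) (m : ZMod n) : Finset (ZMod n) := I.image (· + m)

theorem mem_shift_one (i : ZMod n) : i ∈ shift I 1 ↔ i - 1 ∈ I := by
  simp only [shift, Finset.mem_image]
  exact ⟨fun ⟨j, hj, h⟩ => by simpa [← h] using hj, fun h => ⟨i - 1, h, by simp⟩⟩

theorem mem_shift_two (i : ZMod n) : i ∈ shift I 2 ↔ i - 1 - 1 ∈ I := by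
  have h2 : i - 1 - 1 = i - 2 := by ring
  rw [h2]
  simp only [shift, Finset.mem_image]
  exact ⟨fun ⟨j, hj, h⟩ => by simpa [← h] using hj, fun h => ⟨i - 2, h, by simp⟩⟩

theorem card_shift (hI : I.card = 3) (m : ZMod n) : (shift I m).card = 3 := by
  rw [shift, Finset.card_image_of_injective _ (add_left_injective m), hI]

theorem peak_sub_one (hp : ∀ i ∈ I, i + 1 ∉ I) {i : ZMod n} (h : i - 1 ∈ I) : i ∉ I := by
  simpa using hp _ h

section Values

variable (i : ZMod n)

theorem xVal_add_two_mul_yVal_add_one :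
    xVal (shift I 2) i * yVal (shift I 1) (i - 1) = tser := by
  simp only [xVal, yVal, mem_shift_one, mem_shift_two]
  split_ifs <;> simp

variable {f : ZMod n → Rser}

theorem jump_mul_yVal_add_one (hf : ∀ i, i - 1 ∉ I → f i = f (i - 1)) :
    (f i - f (i - 1)) * yVal (shift I 1) i =
    (f i - f (i - 1)) * tser := by
  by_cases h : i - 1 ∈ I
  · simp [yVal, mem_shift_one, h]
  · simp [hf i h]

theorem jump_mul_xVal_add_one (hf : ∀ i, i - 1 ∉ I → f i = f (i - 1)) :
    (f i - f (i - 1)) * xVal (shift I 1) i =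
    f i - f (i - 1) := by
  by_cases h : i - 1 ∈ I
  · simp [xVal, mem_shift_one, h]
  · simp [hf i h]

theorem jump_mul_xVal_add_two (hf : ∀ i, i - 1 ∉ I → f i = f (i - 1))
    (hp : ∀ i ∈ I, i + 1 ∉ I) :
    (f i - f (i - 1)) * xVal (shift I 2) i =
    (f i - f (i - 1)) * tser := by
  by_cases h : i - 1 ∈ I
  · have h2 : i - 1 - 1 ∉ I := fun h' => peak_sub_one hp h' h
    simp [xVal, mem_shift_two, h2]
  · simp [hf i h]

theorem jump_mul_yVal_add_two (hf : ∀ i, i - 1 ∉ I → f i = f (i - 1))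
    (hp : ∀ i ∈ I, i + 1 ∉ I) :
    (f i - f (i - 1)) * yVal (shift I 2) i =
    f i - f (i - 1) := by
  by_cases h : i - 1 ∈ I
  · have h2 : i - 1 - 1 ∉ I := fun h' => peak_sub_one hp h' h
    simp [yVal, mem_shift_two, h2]
  · simp [hf i h]

theorem jump_mul_xVal (hf : ∀ i, i - 1 ∉ I → f i = f (i - 1))
    (hp : ∀ i ∈ I, i + 1 ∉ I) :
    (f i - f (i - 1)) * xVal I i = (f i - f (i - 1)) * tser := by
  by_cases h : i - 1 ∈ I
  · simp [xVal, peak_sub_one hp h]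
  · simp [hf i h]

theorem jump_mul_yVal (hf : ∀ i, i - 1 ∉ I → f i = f (i - 1))
    (hp : ∀ i ∈ I, i + 1 ∉ I) :
    (f i - f (i - 1)) * yVal I i = f i - f (i - 1) := by
  by_cases h : i - 1 ∈ I
  · simp [yVal, peak_sub_one hp h]
  · simp [hf i h]

theorem mul_xVal_mul_xVal_add_one (hf : ∀ i, i - 1 ∉ I → f i = f (i - 1))
    (hp : ∀ i ∈ I, i + 1 ∉ I) :
    f i * xVal I i * xVal (shift I 1) i =
    xVal I i * (f (i - 1) * xVal I (i - 1)) + (f i - f (i - 1)) * tser := by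
  by_cases h : i - 1 ∈ I
  · simp [xVal, mem_shift_one, h, peak_sub_one hp h]
    ring
  · simp [hf i h, xVal, mem_shift_one, h]
    ring

end Values

/-- The three sets `I`, `I + 2`, `I + 1` labelling the rank-1 factors of the middle term. -/
def middleSets (I : Finset (ZMod n)) : Fin 3 → Finset (ZMod n) :=
  ![I, shift I 2, shift I 1]

/-- The two sets `I + 2`, `I + 1` labelling the rank-1 factors of the end term. -/
def endSets (I : Finset (ZMod n)) : Fin 2 → Finset (ZMod n) :=
  ![shift I 2, shift I 1]

/-- The end term `N` of the almost split sequence. -/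
def endTerm [NeZero n] (D : ArcData n I) (hI : I.card = 3) (hp : ∀ i ∈ I, i + 1 ∉ I) :
    CMMod 3 n 2 :=
  CMMod.ofDiagonalization (endSets I)
    (fun a => by fin_cases a <;> exact card_shift hI _)
    (fun i => !![xVal (shift I 2) i, D.κ i - D.κ (i - 1); 0, xVal (shift I 1) i])
    (fun i => !![yVal (shift I 2) i, -(D.κ i - D.κ (i - 1)); 0, yVal (shift I 1) i])
    (fun i => by
      have h1 := jump_mul_yVal_add_one i D.hκ
      have h2 := jump_mul_xVal_add_two i D.hκ hp
      ext u v : 1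
      fin_cases u <;> fin_cases v <;>
        simp [Matrix.mul_apply, Fin.sum_univ_two, xVal_mul_yVal]
      linear_combination h1 - h2)
    (fun i => by
      have h1 := jump_mul_xVal_add_one i D.hκ
      have h2 := jump_mul_yVal_add_two i D.hκ hp
      ext u v : 1
      fin_cases u <;> fin_cases v <;>
        simp [Matrix.mul_apply, Fin.sum_univ_two, yVal_mul_xVal]
      linear_combination h2 - h1)
    (fun i => !![tser, D.κ i * yVal (shift I 1) i; 0, tser])
    (fun i => !![tser, -(D.κ i * yVal (shift I 1) i); 0, tser])
    (fun i => by
      have h1 := xVal_add_two_mul_yVal_add_one (I := I) i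
      have h2 := yVal_mul_xVal (shift I 1) i
      ext u v : 1
      fin_cases u <;> fin_cases v <;>
        simp [Matrix.mul_apply, Fin.sum_univ_two, Matrix.diagonal_apply, endSets, mul_comm]
      linear_combination D.κ i * h2 - D.κ (i - 1) * h1)
    (fun i => by
      ext u v : 1
      fin_cases u <;> fin_cases v <;>
        simp [Matrix.mul_apply, Fin.sum_univ_two] <;> ring_nf)

/-- The middle term `M` of the almost split sequence. -/
def middleTerm [NeZero n] (D : ArcData n I) (hI : I.card = 3) (hp : ∀ i ∈ I, i + 1 ∉ I) :
    CMMod 3 n 3 :=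
  CMMod.ofDiagonalization (middleSets I)
    (fun a => by
      fin_cases a
      exacts [hI, card_shift hI _, card_shift hI _])
    (fun i => !![xVal I i, 0, D.μ i - D.μ (i - 1);
      0, xVal (shift I 2) i, D.κ i - D.κ (i - 1);
      0, 0, xVal (shift I 1) i])
    (fun i => !![yVal I i, 0, -(D.μ i - D.μ (i - 1));
      0, yVal (shift I 2) i, -(D.κ i - D.κ (i - 1));
      0, 0, yVal (shift I 1) i])
    (fun i => by
      have h1 := jump_mul_yVal_add_one i D.hκ
      have h2 := jump_mul_xVal_add_two i D.hκ hp
      have h3 := jump_mul_yVal_add_one i D.hμ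
      have h4 := jump_mul_xVal i D.hμ hp
      ext u v : 1
      fin_cases u <;> fin_cases v <;>
        simp [Matrix.mul_apply, Fin.sum_univ_three, xVal_mul_yVal]
      · linear_combination h3 - h4
      · linear_combination h1 - h2)
    (fun i => by
      have h1 := jump_mul_xVal_add_one i D.hκ
      have h2 := jump_mul_yVal_add_two i D.hκ hp
      have h3 := jump_mul_xVal_add_one i D.hμ
      have h4 := jump_mul_yVal i D.hμ hp
      ext u v : 1
      fin_cases u <;> fin_cases v <;>
        simp [Matrix.mul_apply, Fin.sum_univ_three, yVal_mul_xVal]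
      · linear_combination h4 - h3
      · linear_combination h2 - h1)
    (fun i => !![tser, 0, D.μ i * xVal I i; 0, tser, D.κ i * yVal (shift I 1) i;
      0, 0, tser])
    (fun i => !![tser, 0, -(D.μ i * xVal I i); 0, tser, -(D.κ i * yVal (shift I 1) i);
      0, 0, tser])
    (fun i => by
      have h1 := xVal_add_two_mul_yVal_add_one (I := I) i
      have h2 := yVal_mul_xVal (shift I 1) i
      have h3 := mul_xVal_mul_xVal_add_one i D.hμ hp
      ext u v : 1
      fin_cases u <;> fin_cases v <;>
        simp [Matrix.mul_apply, Fin.sum_univ_three, Matrix.diagonal_apply, middleSets, mul_comm]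
      · linear_combination h3
      · linear_combination D.κ i * h2 - D.κ (i - 1) * h1)
    (fun i => by
      ext u v : 1
      fin_cases u <;> fin_cases v <;>
        simp [Matrix.mul_apply, Fin.sum_univ_three] <;> ring_nf)

/-- The rank-1 module `L_J`. -/
abbrev rankOne [NeZero n] {k : ℕ} {J : Finset (ZMod n)} (hJ : J.card = k) : CMMod k n 1 :=
  sumRankOne (fun _ : Fin 1 => J) fun _ => hJ

/-- The sum `L_I ⊕ L_{I + 2}`. -/
abbrev splitPart [NeZero n] (hI : I.card = 3) : CMMod 3 n 2 :=
  sumRankOne ![I, shift I 2] fun a => by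
    fin_cases a
    exacts [hI, card_shift hI _]

section Sequences

variable [NeZero n] (D : ArcData n I) (hI : I.card = 3) (hp : ∀ i ∈ I, i + 1 ∉ I)

/-- The sequence `0 → L_{I + 2} → N → L_{I + 1} → 0`. -/
def endTermSes : CMses (rankOne (card_shift hI 2)) (endTerm D hI hp)
    (rankOne (card_shift hI 1)) :=
  CMses.ofSplitAtVertices
    (CMHom.ofX (fun _ => !![1; 0]) fun i => by
      ext u v : 1
      fin_cases u <;> fin_cases v <;>
        simp [Matrix.mul_apply, Fin.sum_univ_two, endTerm, sumRankOne, CMMod.ofDiagonalization])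
    (CMHom.ofX (fun _ => !![0, 1]) fun i => by
      ext u v : 1
      fin_cases u <;> fin_cases v <;>
        simp [Matrix.mul_apply, Fin.sum_univ_two, endTerm, sumRankOne, CMMod.ofDiagonalization])
    !![1, 0] !![0; 1]
    (fun i => by
      ext u v : 1
      fin_cases u <;> fin_cases v <;> simp [CMHom.ofX])
    (fun i => by
      ext u v : 1
      fin_cases u <;> fin_cases v <;> simp [CMHom.ofX])
    (fun i => by
      ext u v : 1
      fin_cases u <;> fin_cases v <;> simp [CMHom.ofX])
    (fun i => by
      ext u v : 1
      fin_cases u <;> fin_cases v <;> simp [CMHom.ofX])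

/-- The sequence `0 → L_{I + 2} → L_I ⊕ L_{I + 2} → L_I → 0`. -/
def splitPartSes : CMses (rankOne (card_shift hI 2)) (splitPart hI) (rankOne hI) :=
  CMses.ofSplitAtVertices
    (CMHom.ofX (fun _ => !![0; 1]) fun i => by
      ext u v : 1
      fin_cases u <;> fin_cases v <;>
        simp [Matrix.mul_apply, Fin.sum_univ_two, sumRankOne, CMMod.ofDiagonalization])
    (CMHom.ofX (fun _ => !![1, 0]) fun i => by
      ext u v : 1
      fin_cases u <;> fin_cases v <;>
        simp [Matrix.mul_apply, Fin.sum_univ_two, sumRankOne, CMMod.ofDiagonalization])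
    !![0, 1] !![1; 0]
    (fun i => by
      ext u v : 1
      fin_cases u <;> fin_cases v <;> simp [CMHom.ofX])
    (fun i => by
      ext u v : 1
      fin_cases u <;> fin_cases v <;> simp [CMHom.ofX])
    (fun i => by
      ext u v : 1
      fin_cases u <;> fin_cases v <;> simp [CMHom.ofX])
    (fun i => by
      ext u v : 1
      fin_cases u <;> fin_cases v <;> simp [CMHom.ofX])

/-- The sequence `0 → L_I ⊕ L_{I + 2} → M → L_{I + 1} → 0`. -/
def middleTermSes : CMses (splitPart hI) (middleTerm D hI hp) (rankOne (card_shift hI 1)) :=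
  CMses.ofSplitAtVertices
    (CMHom.ofX (fun _ => !![1, 0; 0, 1; 0, 0]) fun i => by
      ext u v : 1
      fin_cases u <;> fin_cases v <;>
        simp [Matrix.mul_apply, Fin.sum_univ_two, Fin.sum_univ_three, middleTerm, sumRankOne,
          CMMod.ofDiagonalization])
    (CMHom.ofX (fun _ => !![0, 0, 1]) fun i => by
      ext u v : 1
      fin_cases u <;> fin_cases v <;>
        simp [Matrix.mul_apply, Fin.sum_univ_three, middleTerm, sumRankOne,
          CMMod.ofDiagonalization])
    !![1, 0, 0; 0, 1, 0] !![0; 0; 1]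
    (fun i => by
      ext u v : 1
      fin_cases u <;> fin_cases v <;> simp [CMHom.ofX])
    (fun i => by
      ext u v : 1
      fin_cases u <;> fin_cases v <;> simp [CMHom.ofX])
    (fun i => by
      ext u v : 1
      fin_cases u <;> fin_cases v <;> simp [CMHom.ofX])
    (fun i => by
      ext u v : 1
      fin_cases u <;> fin_cases v <;> simp [CMHom.ofX])

/-- The sequence `0 → L_I → M → N → 0`. -/
def arSequence : CMses (rankOne hI) (middleTerm D hI hp) (endTerm D hI hp) :=
  CMses.ofSplitAtVertices
    (CMHom.ofX (fun _ => !![1; 0; 0]) fun i => by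
      ext u v : 1
      fin_cases u <;> fin_cases v <;>
        simp [Matrix.mul_apply, Fin.sum_univ_three, middleTerm, sumRankOne,
          CMMod.ofDiagonalization])
    (CMHom.ofX (fun _ => !![0, 1, 0; 0, 0, 1]) fun i => by
      ext u v : 1
      fin_cases u <;> fin_cases v <;>
        simp [Matrix.mul_apply, Fin.sum_univ_two, Fin.sum_univ_three, middleTerm, endTerm,
          CMMod.ofDiagonalization])
    !![1, 0, 0] !![0, 0; 1, 0; 0, 1]
    (fun i => by
      ext u v : 1
      fin_cases u <;> fin_cases v <;> simp [CMHom.ofX])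
    (fun i => by
      ext u v : 1
      fin_cases u <;> fin_cases v <;> simp [CMHom.ofX])
    (fun i => by
      ext u v : 1
      fin_cases u <;> fin_cases v <;> simp [CMHom.ofX])
    (fun i => by
      ext u v : 1
      fin_cases u <;> fin_cases v <;> simp [CMHom.ofX])

theorem hasFiltration_endTerm :
    HasFiltration (endTerm D hI hp) [I.image (· + 1), I.image (· + 2)] :=
  .step (isRankOne_sumRankOne _ _) (.base (isRankOne_sumRankOne _ _)) ⟨endTermSes D hI hp⟩

theorem hasFiltration_middleTerm :
    HasFiltration (middleTerm D hI hp) [I.image (· + 1), I, I.image (· + 2)] :=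
  .step (isRankOne_sumRankOne _ _)
    (.step (isRankOne_sumRankOne _ _) (.base (isRankOne_sumRankOne _ _)) ⟨splitPartSes hI⟩)
    ⟨middleTermSes D hI hp⟩

end Sequences

end Construction

section Endomorphisms

/-- The inverse of a morphism consisting of invertible matrices. -/
def CMHom.inverse {k n s : ℕ} {M : CMMod k n s} (f : CMHom M M) (hf : ∀ i, IsUnit (f.F i).det) :
    CMHom M M :=
  CMHom.ofX (fun i => (f.F i)⁻¹) fun i => by
    have h := f.hX i
    calc (f.F i)⁻¹ * M.X i = (f.F i)⁻¹ * (M.X i * f.F (i - 1)) * (f.F (i - 1))⁻¹ := by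
          rw [Matrix.mul_assoc, Matrix.mul_assoc, Matrix.mul_nonsing_inv _ (hf _), Matrix.mul_one]
      _ = M.X i * (f.F (i - 1))⁻¹ := by
          rw [← h, ← Matrix.mul_assoc, Matrix.nonsing_inv_mul _ (hf _), Matrix.one_mul]

theorem indecomposable_rank_one {k n : ℕ} [NeZero n] {J : Finset (ZMod n)} (hJ : J.card = k) :
    Indecomposable (rankOne hJ) := by
  intro f hf
  have hc : ∀ i, f.F i 0 0 = f.F (i - 1) 0 0 := by
    intro i
    have h := congrFun (congrFun (f.hX i) 0) 0
    simp only [rankOne, sumRankOne, CMMod.ofDiagonalization, Matrix.mul_apply, Fin.sum_univ_one,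
      Matrix.diagonal_apply_eq] at h
    rw [mul_comm] at h
    exact mul_left_cancel₀ (xVal_ne_zero J i) h
  have hc := zmod_const hc
  have h0 := congrFun (congrFun (hf 0) 0) 0
  simp only [Matrix.mul_apply, Fin.sum_univ_one] at h0
  have ext1 : ∀ A B : Matrix (Fin 1) (Fin 1) Rser, A 0 0 = B 0 0 → A = B := by
    intro A B h
    ext u v : 1
    rw [Fin.fin_one_eq_zero u, Fin.fin_one_eq_zero v, h]
  rcases IsIdempotentElem.iff_eq_zero_or_one.1 h0 with h | h
  · exact Or.inl fun i => ext1 _ _ (by rw [hc i 0, h]; rfl)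
  · exact Or.inr fun i => ext1 _ _ (by rw [hc i 0, h]; rfl)

variable {n : ℕ} {I : Finset (ZMod n)} [NeZero n] (D : ArcData n I) (hI : I.card = 3)
  (hp : ∀ i ∈ I, i + 1 ∉ I)

theorem endTerm_end_apply (f : CMHom (endTerm D hI hp) (endTerm D hI hp)) (i : ZMod n) :
    f.F i 0 0 * xVal (shift I 2) i =
        xVal (shift I 2) i * f.F (i - 1) 0 0 + (D.κ i - D.κ (i - 1)) * f.F (i - 1) 1 0 ∧
      f.F i 0 0 * (D.κ i - D.κ (i - 1)) + f.F i 0 1 * xVal (shift I 1) i =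
        xVal (shift I 2) i * f.F (i - 1) 0 1 + (D.κ i - D.κ (i - 1)) * f.F (i - 1) 1 1 ∧
      f.F i 1 0 * xVal (shift I 2) i = xVal (shift I 1) i * f.F (i - 1) 1 0 ∧
      f.F i 1 0 * (D.κ i - D.κ (i - 1)) + f.F i 1 1 * xVal (shift I 1) i =
        xVal (shift I 1) i * f.F (i - 1) 1 1 := by
  have h := fun u v => congrFun (congrFun (f.hX i) u) v
  simp only [endTerm, CMMod.ofDiagonalization, Matrix.mul_apply, Fin.sum_univ_two] at h
  refine ⟨?_, ?_, ?_, ?_⟩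
  · simpa using h 0 0
  · simpa using h 0 1
  · simpa using h 1 0
  · simpa using h 1 1

/-- Modulo `t`, the diagonal entries of an endomorphism of `N` are equal and constant, and it is
upper triangular. -/
theorem exists_endTerm_end_constantCoeff (f : CMHom (endTerm D hI hp) (endTerm D hI hp)) :
    ∃ z : ℂ, ∀ i, PowerSeries.constantCoeff (f.F i 1 0) = 0 ∧
      PowerSeries.constantCoeff (f.F i 0 0) = z ∧ PowerSeries.constantCoeff (f.F i 1 1) = z := by
  have E := endTerm_end_apply D hI hp f
  have ha : D.a ∈ I := (D.mem_iff _).2 (Or.inl rfl)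
  have hb : D.b ∈ I := (D.mem_iff _).2 (Or.inr (Or.inl rfl))
  have hc : D.c ∈ I := (D.mem_iff _).2 (Or.inr (Or.inr rfl))
  obtain ⟨w, hw⟩ : ∃ w, ∀ i, f.F i 1 0 * yVal (shift I 1) i = w := by
    refine ⟨_, fun i => zmod_const (f := fun i => f.F i 1 0 * yVal (shift I 1) i) ?_ i 0⟩
    intro i
    refine mul_left_cancel₀ tser_ne_zero ?_
    linear_combination yVal (shift I 1) (i - 1) * yVal (shift I 1) i * (E i).2.2.1 -
      f.F i 1 0 * yVal (shift I 1) i * xVal_add_two_mul_yVal_add_one (I := I) i +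
      f.F (i - 1) 1 0 * yVal (shift I 1) (i - 1) * xVal_mul_yVal (shift I 1) i
  set q := f.F (D.a + 1) 1 0 with hq
  have hwq : w = q * tser := by
    rw [← hw (D.a + 1)]; simp [yVal, mem_shift_one, ha, hq]
  have q1 : ∀ i, i - 1 ∈ I → f.F i 1 0 = q := by
    intro i hi
    have h := hw i
    rw [yVal, if_pos ((mem_shift_one i).2 hi), hwq] at h
    exact mul_right_cancel₀ tser_ne_zero h
  have q2 : ∀ i, i - 1 ∉ I → f.F i 1 0 = q * tser := by
    intro i hi
    have h := hw i
    rwa [yVal, if_neg (mt (mem_shift_one i).1 hi), hwq, mul_one] at h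
  have q3 : ∀ i, i - 1 ∈ I → i - 1 - 1 ∉ I := fun i hi h => peak_sub_one hp h hi
  obtain ⟨V, hV⟩ : ∃ V, ∀ i, f.F i 1 1 + q * D.κ i = V := by
    refine ⟨_, fun i => zmod_const (f := fun i => f.F i 1 1 + q * D.κ i) ?_ i 0⟩
    intro i
    have h := (E i).2.2.2
    by_cases hi : i - 1 ∈ I
    · rw [q1 i hi, xVal, if_pos ((mem_shift_one i).2 hi)] at h
      linear_combination h
    · rw [D.hκ i hi, sub_self] at h
      rw [D.hκ i hi, mul_right_cancel₀ (xVal_ne_zero (shift I 1) i)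
        (show f.F i 1 1 * _ = f.F (i - 1) 1 1 * _ by linear_combination h)]
  obtain ⟨U, hU⟩ : ∃ U, ∀ i, f.F i 0 0 - q * D.κ i = U := by
    refine ⟨_, fun i => zmod_const (f := fun i => f.F i 0 0 - q * D.κ i) ?_ i 0⟩
    intro i
    have h := (E i).1
    by_cases hi : i - 1 ∈ I
    · rw [q2 _ (q3 i hi), xVal, if_neg (mt (mem_shift_two i).1 (q3 i hi))] at h
      refine mul_left_cancel₀ tser_ne_zero ?_
      linear_combination h
    · rw [D.hκ i hi, sub_self] at h
      rw [D.hκ i hi, mul_right_cancel₀ (xVal_ne_zero (shift I 2) i)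
        (show f.F i 0 0 * _ = f.F (i - 1) 0 0 * _ by linear_combination h)]
  have P : ∀ i ∈ I, ∃ r, (U + q * D.κ (i + 1) - (V - q * D.κ i)) * (D.κ (i + 1) - D.κ i) =
      tser * r := by
    intro i hi
    have h1 := (E (i + 1)).2.1
    have h2 := (E (i + 1 + 1)).2.1
    have h3 : i - 1 ∉ I := fun h => peak_sub_one hp h hi
    simp only [add_sub_cancel_right] at h1 h2
    rw [xVal, if_pos ((mem_shift_one (i + 1)).2 (by simpa using hi)), xVal,
      if_neg (mt (mem_shift_two (i + 1)).1 (by simpa using h3))] at h1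
    rw [D.hκ (i + 1 + 1) (by simpa using hp i hi), xVal,
      if_neg (mt (mem_shift_one (i + 1 + 1)).1 (by simpa using hp i hi)), xVal,
      if_pos ((mem_shift_two (i + 1 + 1)).2 (by simpa using hi))] at h2
    simp only [add_sub_cancel_right] at h2
    refine ⟨f.F i 0 1 - f.F (i + 1 + 1) 0 1, ?_⟩
    linear_combination h1 + h2 + (D.κ (i + 1) - D.κ i) * (hV i - hU (i + 1))
  have Pa := P _ ha
  have Pb := P _ hb
  have Pc := P _ hc
  rw [D.κa, D.κa'] at Pa
  rw [D.κb, D.κb'] at Pb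
  rw [D.κc, D.κc'] at Pc
  have cc : ∀ x r : Rser, x = tser * r → PowerSeries.constantCoeff x = 0 := fun x r h => by
    rw [h, map_mul, constantCoeff_tser, zero_mul]
  obtain ⟨r, Pa⟩ := Pa
  obtain ⟨r', Pb⟩ := Pb
  obtain ⟨r'', Pc⟩ := Pc
  have Pa := cc _ _ Pa
  have Pb := cc _ _ Pb
  have Pc := cc _ _ Pc
  simp only [map_mul, map_add, map_sub, map_neg, map_one, map_zero] at Pa Pb Pc
  have hUV : PowerSeries.constantCoeff U = PowerSeries.constantCoeff V := by
    linear_combination -(1 / 2) * Pb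
  have hq0 : PowerSeries.constantCoeff q = 0 := by
    linear_combination Pa - hUV
  refine ⟨PowerSeries.constantCoeff V, fun i => ⟨?_, ?_, ?_⟩⟩
  · by_cases hi : i - 1 ∈ I
    · rw [q1 i hi, hq0]
    · rw [q2 i hi, map_mul, hq0, zero_mul]
  · rw [← hUV, ← hU i, map_sub, map_mul, hq0, zero_mul, sub_zero]
  · rw [← hV i, map_add, map_mul, hq0, zero_mul, add_zero]

theorem isUnit_det_of_constantCoeff {A : Matrix (Fin 2) (Fin 2) Rser} {z : ℂ} (hz : z ≠ 0)
    (h10 : PowerSeries.constantCoeff (A 1 0) = 0) (h00 : PowerSeries.constantCoeff (A 0 0) = z)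
    (h11 : PowerSeries.constantCoeff (A 1 1) = z) : IsUnit A.det := by
  rw [PowerSeries.isUnit_iff_constantCoeff, Matrix.det_fin_two, map_sub, map_mul, map_mul, h10,
    h00, h11]
  simpa using hz

theorem indecomposable_endTerm : Indecomposable (endTerm D hI hp) := by
  intro f hf
  obtain ⟨z, hz⟩ := exists_endTerm_end_constantCoeff D hI hp f
  have h0 := congrArg PowerSeries.constantCoeff (congrFun (congrFun (hf 0) 0) 0)
  simp only [Matrix.mul_apply, Fin.sum_univ_two, map_add, map_mul, (hz 0).1, (hz 0).2.1] at h0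
  rw [mul_zero, add_zero] at h0
  rcases IsIdempotentElem.iff_eq_zero_or_one.1 h0 with h | h
  · left
    intro i
    have hu : IsUnit (1 - f.F i).det := by
      refine isUnit_det_of_constantCoeff one_ne_zero ?_ ?_ ?_ <;> simp [hz i, h]
    have := (Matrix.isUnit_iff_isUnit_det _).2 hu
    refine this.mul_left_cancel ?_
    rw [sub_mul, hf, one_mul, sub_self, mul_zero]
  · right
    intro i
    have hu : IsUnit (f.F i).det :=
      isUnit_det_of_constantCoeff (z := z) (by simp [h]) (hz i).1 (hz i).2.1 (hz i).2.2
    have := (Matrix.isUnit_iff_isUnit_det _).2 hu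
    refine this.mul_left_cancel ?_
    rw [hf, mul_one]

theorem not_splits_arSequence : ¬ (arSequence D hI hp).Splits := by
  rintro ⟨ρ, hρ⟩
  have ha : D.a ∈ I := (D.mem_iff _).2 (Or.inl rfl)
  have hb : D.b ∈ I := (D.mem_iff _).2 (Or.inr (Or.inl rfl))
  have hc : D.c ∈ I := (D.mem_iff _).2 (Or.inr (Or.inr rfl))
  have h0 : ∀ i, ρ.F i 0 0 = 1 := by
    intro i
    have h := congrFun (congrFun (hρ i) 0) 0
    simpa [arSequence, CMses.ofSplitAtVertices, CMHom.ofX, Matrix.mul_apply, Fin.sum_univ_three]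
      using h
  have hX := fun i v => congrFun (congrFun (ρ.hX i) 0) v
  simp only [middleTerm, rankOne, sumRankOne, CMMod.ofDiagonalization, Matrix.mul_apply,
    Fin.sum_univ_three, Fin.sum_univ_one, Matrix.diagonal_apply_eq] at hX
  have h1 : ∀ i, ρ.F i 0 1 * xVal (shift I 2) i = xVal I i * ρ.F (i - 1) 0 1 := by
    intro i
    simpa using hX i 1
  have h2 : ∀ i, (D.μ i - D.μ (i - 1)) + ρ.F i 0 1 * (D.κ i - D.κ (i - 1)) +
      ρ.F i 0 2 * xVal (shift I 1) i = xVal I i * ρ.F (i - 1) 0 2 := by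
    intro i
    simpa [h0] using hX i 2
  clear hX
  have hyy : ∀ i, yVal (shift I 1) i = yVal I (i - 1) := by
    intro i; simp only [yVal, mem_shift_one]
  obtain ⟨w, hw⟩ : ∃ w, ∀ i, ρ.F i 0 1 * (yVal I i * yVal (shift I 1) i) = w := by
    refine ⟨_, fun i =>
      zmod_const (f := fun i => ρ.F i 0 1 * (yVal I i * yVal (shift I 1) i)) ?_ i 0⟩
    intro i
    refine mul_left_cancel₀ tser_ne_zero ?_
    linear_combination yVal I i * yVal (shift I 1) i * yVal (shift I 1) (i - 1) * h1 i -
      ρ.F i 0 1 * yVal I i * yVal (shift I 1) i * xVal_add_two_mul_yVal_add_one (I := I) i +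
      ρ.F (i - 1) 0 1 * yVal (shift I 1) i * yVal (shift I 1) (i - 1) * xVal_mul_yVal I i +
      tser * ρ.F (i - 1) 0 1 * yVal (shift I 1) (i - 1) * hyy i
  set r := ρ.F (D.a + 1) 0 1 with hr
  have hwr : w = r * tser := by
    rw [← hw (D.a + 1), hyy, add_sub_cancel_right]
    simp [yVal, ha, hr, hp _ ha]
  have r1 : ∀ i, i - 1 ∈ I → ρ.F i 0 1 = r := by
    intro i hi
    have h := hw i
    rw [hyy, yVal, yVal, if_pos hi, if_neg (peak_sub_one hp hi), hwr, one_mul] at h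
    exact mul_right_cancel₀ tser_ne_zero h
  obtain ⟨m, hm⟩ : ∃ m, ∀ i, yVal I i * ρ.F i 0 2 + D.μ i + r * D.κ i = m := by
    refine ⟨_, fun i =>
      zmod_const (f := fun i => yVal I i * ρ.F i 0 2 + D.μ i + r * D.κ i) ?_ i 0⟩
    intro i
    have h := h2 i
    by_cases hi : i - 1 ∈ I
    · rw [r1 i hi, xVal, if_pos ((mem_shift_one i).2 hi), xVal,
        if_neg (peak_sub_one hp hi)] at h
      simp only [yVal]
      rw [if_pos hi, if_neg (peak_sub_one hp hi)]
      linear_combination h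
    · rw [D.hκ i hi, D.hμ i hi, xVal, if_neg (mt (mem_shift_one i).1 hi)] at h
      rw [D.hκ i hi, D.hμ i hi]
      have h3 : yVal I (i - 1) = 1 := if_neg hi
      refine mul_left_cancel₀ tser_ne_zero ?_
      linear_combination yVal I i * h + ρ.F (i - 1) 0 2 * xVal_mul_yVal I i -
        tser * ρ.F (i - 1) 0 2 * h3
  have Ha := congrArg PowerSeries.constantCoeff (hm D.a)
  have Hb := congrArg PowerSeries.constantCoeff (hm D.b)
  have Hc := congrArg PowerSeries.constantCoeff (hm D.c)
  have hy : ∀ i ∈ I, PowerSeries.constantCoeff (yVal I i) = 0 := fun i hi => by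
    rw [yVal, if_pos hi, constantCoeff_tser]
  simp only [map_add, map_mul, hy _ ha, hy _ hb, hy _ hc, D.κa, D.κb, D.κc, D.μa, D.μb, D.μc,
    map_one, map_zero, map_neg] at Ha Hb Hc
  have : (1 : ℂ) = 0 := by linear_combination Ha - Hb / 2 - Hc / 2
  exact one_ne_zero this

end Endomorphisms

section Integrality

open scoped Matrix

/-- The lattice of vectors with entries in `ℂ⟦t⟧`. -/
def integralVectors (s : ℕ) : Submodule Rser (Fin s → Kser) :=
  LinearMap.range ((Algebra.linearMap Rser Kser).compLeft (Fin s))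

theorem mem_integralVectors {s : ℕ} {v : Fin s → Kser} :
    v ∈ integralVectors s ↔ ∃ z : Fin s → Rser, v = algebraMap Rser Kser ∘ z :=
  ⟨fun ⟨z, hz⟩ => ⟨z, hz.symm⟩, fun ⟨z, hz⟩ => ⟨z, hz.symm⟩⟩

theorem algebraMap_smul_mem {s : ℕ} {v : Fin s → Kser} (r : Rser) (hv : v ∈ integralVectors s) :
    algebraMap Rser Kser r • v ∈ integralVectors s := by
  rw [algebraMap_smul]
  exact Submodule.smul_mem _ r hv

theorem map_comp_mulVec {s s' : ℕ} (A : Matrix (Fin s') (Fin s) Rser) (z : Fin s → Rser) :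
    A.map (algebraMap Rser Kser) *ᵥ (algebraMap Rser Kser ∘ z) =
      algebraMap Rser Kser ∘ (A *ᵥ z) :=
  funext fun i => (RingHom.map_mulVec _ A z i).symm

theorem map_comp_vecMul {s s' : ℕ} (A : Matrix (Fin s') (Fin s) Rser) (z : Fin s' → Rser) :
    (algebraMap Rser Kser ∘ z) ᵥ* A.map (algebraMap Rser Kser) =
      algebraMap Rser Kser ∘ (z ᵥ* A) :=
  funext fun i => (RingHom.map_vecMul _ A z i).symm

theorem mulVec_mem {s s' : ℕ} (A : Matrix (Fin s') (Fin s) Rser) {v : Fin s → Kser}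
    (hv : v ∈ integralVectors s) : A.map (algebraMap Rser Kser) *ᵥ v ∈ integralVectors s' := by
  obtain ⟨z, rfl⟩ := mem_integralVectors.1 hv
  exact mem_integralVectors.2 ⟨_, map_comp_mulVec A z⟩

theorem vecMul_mem {s s' : ℕ} (A : Matrix (Fin s') (Fin s) Rser) {v : Fin s' → Kser}
    (hv : v ∈ integralVectors s') : v ᵥ* A.map (algebraMap Rser Kser) ∈ integralVectors s := by
  obtain ⟨z, rfl⟩ := mem_integralVectors.1 hv
  exact mem_integralVectors.2 ⟨_, map_comp_vecMul A z⟩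

theorem map_algebraMap_mul_of_eq_smul_one {s : ℕ} {A B : Matrix (Fin s) (Fin s) Rser}
    (h : A * B = tser • (1 : Matrix (Fin s) (Fin s) Rser)) :
    A.map (algebraMap Rser Kser) * B.map (algebraMap Rser Kser) = tK • 1 := by
  rw [← Matrix.map_mul, h]
  ext u v : 1
  by_cases huv : u = v <;> simp [tK, huv]

theorem map_Y_mul_eq {k n s : ℕ} (Z : CMMod k n s) {I : Finset (ZMod n)}
    {P : ZMod n → Matrix (Fin s) (Fin s) Kser}
    (hP : ∀ i, (Z.X i).map (algebraMap Rser Kser) * P (i - 1) =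
      algebraMap Rser Kser (xVal I i) • P i) (i : ZMod n) :
    (Z.Y i).map (algebraMap Rser Kser) * P i = algebraMap Rser Kser (yVal I i) • P (i - 1) := by
  have h := congrArg (fun A => algebraMap Rser Kser (yVal I i) •
    ((Z.Y i).map (algebraMap Rser Kser) * A)) (hP i)
  simp only [← Matrix.mul_assoc, map_algebraMap_mul_of_eq_smul_one (Z.hYX i), Matrix.smul_mul,
    Matrix.one_mul, Matrix.mul_smul, smul_smul, ← map_mul, yVal_mul_xVal] at h
  rw [mul_comm, ← smul_smul] at h
  exact (smul_right_injective _ tK_ne_zero h).symm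

end Integrality

section Lifting

open scoped Matrix

theorem xVal_shift_one {n : ℕ} (I : Finset (ZMod n)) (i : ZMod n) : xVal (shift I 1) i = xVal I (i - 1) := by
  simp only [xVal, mem_shift_one]

theorem xVal_shift_two {n : ℕ} (I : Finset (ZMod n)) (i : ZMod n) : xVal (shift I 2) i = xVal (shift I 1) (i - 1) := by
  simp only [xVal, mem_shift_one, mem_shift_two]

theorem isUnit_jump {n : ℕ} {I : Finset (ZMod n)} (D : ArcData n I) {i : ZMod n} (hi : i - 1 ∈ I) : IsUnit (D.κ i - D.κ (i - 1)) := by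
  obtain ⟨j, rfl⟩ : ∃ j, i = j + 1 := ⟨i - 1, by ring⟩
  rw [add_sub_cancel_right] at hi ⊢
  rw [PowerSeries.isUnit_iff_constantCoeff]
  rcases (D.mem_iff j).1 hi with rfl | rfl | rfl
  · simp [D.κa, D.κa']
  · rw [D.κb, D.κb', map_sub, map_neg, map_one]; norm_num
  · simp [D.κc, D.κc']

variable {n s : ℕ} {I : Finset (ZMod n)} [NeZero n] (D : ArcData n I) (hI : I.card = 3)
  (hp : ∀ i ∈ I, i + 1 ∉ I)

/-- A pair of vectors over the fraction field, integral along `I`, defines a morphism from `N`. -/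
theorem exists_hom_of_integral (Z : CMMod 3 n s) {P : ZMod n → Matrix (Fin s) (Fin s) Kser}
    (hP : ∀ i, (Z.X i).map (algebraMap Rser Kser) * P (i - 1) =
      algebraMap Rser Kser (xVal I i) • P i) (v w : Fin s → Kser)
    (hvw : ∀ i ∈ I, P i *ᵥ (v - algebraMap Rser Kser (D.κ i) • w) ∈ integralVectors s) :
    ∃ G : CMHom (endTerm D hI hp) Z, ∀ i ∈ I, (fun j => algebraMap Rser Kser (G.F i j 1)) =
      P i *ᵥ (v - algebraMap Rser Kser (D.κ i) • w) := by
  have hPY := map_Y_mul_eq Z hP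
  set A : ZMod n → Fin s → Kser := fun i =>
    algebraMap Rser Kser (xVal I i * xVal I (i - 1)) • P i *ᵥ w with hA
  set B : ZMod n → Fin s → Kser := fun i =>
    algebraMap Rser Kser (xVal I i) • P i *ᵥ (v - algebraMap Rser Kser (D.κ i) • w) with hB
  have hX : ∀ i x, (Z.X i).map (algebraMap Rser Kser) *ᵥ (P (i - 1) *ᵥ x) =
      algebraMap Rser Kser (xVal I i) • P i *ᵥ x := by
    intro i x
    rw [Matrix.mulVec_mulVec, hP, Matrix.smul_mulVec]
  have hY : ∀ i x, (Z.Y i).map (algebraMap Rser Kser) *ᵥ (P i *ᵥ x) =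
      algebraMap Rser Kser (yVal I i) • P (i - 1) *ᵥ x := by
    intro i x
    rw [Matrix.mulVec_mulVec, hPY, Matrix.smul_mulVec]
  have relA : ∀ i, (Z.X i).map (algebraMap Rser Kser) *ᵥ A (i - 1) =
      algebraMap Rser Kser (xVal I (i - 1 - 1)) • A i := by
    intro i
    simp only [hA]
    rw [Matrix.mulVec_smul, hX, smul_smul, smul_smul, ← map_mul, ← map_mul]
    congr 2; ring
  have relB : ∀ i, (Z.X i).map (algebraMap Rser Kser) *ᵥ B (i - 1) =
      algebraMap Rser Kser (D.κ i - D.κ (i - 1)) • A i +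
        algebraMap Rser Kser (xVal I (i - 1)) • B i := by
    intro i
    simp only [hA, hB]
    rw [Matrix.mulVec_smul, hX]
    simp only [Matrix.mulVec_sub, Matrix.mulVec_smul, map_mul, map_sub]
    ext j
    simp only [Pi.smul_apply, Pi.sub_apply, Pi.add_apply, smul_eq_mul]
    ring
  have relA' : ∀ i, (Z.Y i).map (algebraMap Rser Kser) *ᵥ A i =
      tK • algebraMap Rser Kser (xVal I (i - 1)) • P (i - 1) *ᵥ w := by
    intro i
    simp only [hA]
    rw [Matrix.mulVec_smul, hY, smul_smul, smul_smul, tK, ← xVal_mul_yVal I i]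
    simp only [map_mul]
    congr 1; ring
  have hBint : ∀ i, B i ∈ integralVectors s := by
    have ha : D.a ∈ I := (D.mem_iff _).2 (Or.inl rfl)
    have hBI : ∀ i ∈ I, B i ∈ integralVectors s := by
      intro i hi
      simp only [hB]
      exact algebraMap_smul_mem _ (hvw i hi)
    refine zmod_pred_induction D.a (hBI _ ha) fun i hi => ?_
    by_cases h : i - 1 ∈ I
    · exact hBI _ h
    · have := mulVec_mem (Z.Y i) hi
      simp only [hB] at this ⊢
      rw [Matrix.mulVec_smul, hY, smul_smul, ← map_mul, xVal_mul_yVal, D.hκ i h] at this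
      rwa [xVal, if_neg h]
  have hAint : ∀ i, A i ∈ integralVectors s := by
    have hAX : ∀ i, i - 1 ∈ I → A i ∈ integralVectors s := by
      intro i hi
      obtain ⟨u, hu⟩ := (isUnit_jump D hi).exists_left_inv
      have h1 : A i = algebraMap Rser Kser u • ((Z.X i).map (algebraMap Rser Kser) *ᵥ B (i - 1) -
          algebraMap Rser Kser (xVal I (i - 1)) • B i) := by
        rw [relB, add_sub_cancel_right, smul_smul, ← map_mul, hu, map_one, one_smul]
      rw [h1]
      exact algebraMap_smul_mem _ (Submodule.sub_mem _ (mulVec_mem _ (hBint _))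
        (algebraMap_smul_mem _ (hBint _)))
    have ha : D.a ∈ I := (D.mem_iff _).2 (Or.inl rfl)
    refine zmod_pred_induction (D.a + 1) (hAX _ (by simpa using ha)) fun i hi => ?_
    by_cases h : i - 1 - 1 ∈ I
    · exact hAX _ h
    · have := mulVec_mem (Z.Y i) hi
      rw [relA'] at this
      simp only [hA]
      rwa [xVal, xVal, if_neg h, mul_comm, map_mul, ← smul_smul]
  choose zA hzA using fun i => mem_integralVectors.1 (hAint i)
  choose zB hzB using fun i => mem_integralVectors.1 (hBint i)
  have inj : Function.Injective (fun z : Fin s → Rser => algebraMap Rser Kser ∘ z) :=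
    (IsFractionRing.injective Rser Kser).comp_left
  have sA : ∀ i, Z.X i *ᵥ zA (i - 1) = xVal I (i - 1 - 1) • zA i := by
    intro i
    apply inj
    have := relA i
    rw [hzA, hzA, map_comp_mulVec] at this
    refine this.trans (funext fun j => ?_)
    simp
  have sB : ∀ i, Z.X i *ᵥ zB (i - 1) = (D.κ i - D.κ (i - 1)) • zA i + xVal I (i - 1) • zB i := by
    intro i
    apply inj
    have := relB i
    rw [hzA, hzB, hzB, map_comp_mulVec] at this
    refine this.trans (funext fun j => ?_)
    simp [Algebra.smul_def]
  refine ⟨CMHom.ofX (fun i => Matrix.of fun j => ![zA i j, zB i j]) fun i => ?_, fun i hi => ?_⟩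
  · ext j l : 1
    have hA' := congrFun (sA i) j
    have hB' := congrFun (sB i) j
    fin_cases l
    · simp [Matrix.mul_apply, Fin.sum_univ_two, endTerm, CMMod.ofDiagonalization, xVal_shift_two,
        xVal_shift_one, Matrix.mulVec, dotProduct] at hA' ⊢
      rw [hA', mul_comm]
    · simp [Matrix.mul_apply, Fin.sum_univ_two, endTerm, CMMod.ofDiagonalization,
        xVal_shift_one, Matrix.mulVec, dotProduct] at hB' ⊢
      rw [hB', mul_comm, mul_comm (xVal _ _)]
  · have := hzB i
    simp only [hB] at this
    rw [xVal, if_pos hi, map_one, one_smul] at this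
    rw [this]
    ext j
    simp [CMHom.ofX]

/-- A morphism to `N` which is not a split epimorphism satisfies a divisibility constraint along
`I`. -/
theorem tser_dvd_of_not_isSplitEpi {Z : CMMod 3 n s} (f : CMHom Z (endTerm D hI hp))
    (hf : ¬ IsSplitEpi f) {P Q : ZMod n → Matrix (Fin s) (Fin s) Kser}
    (hPQ : ∀ i, P i * Q i = 1)
    (hP : ∀ i, (Z.X i).map (algebraMap Rser Kser) * P (i - 1) =
      algebraMap Rser Kser (xVal I i) • P i) (za zb zc : Fin s → Rser)
    (hz : (2 : Kser) • Q D.a *ᵥ (algebraMap Rser Kser ∘ za) =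
      Q D.b *ᵥ (algebraMap Rser Kser ∘ zb) + Q D.c *ᵥ (algebraMap Rser Kser ∘ zc)) :
    tser ∣ f.F D.a 1 ⬝ᵥ za := by
  set v := Q D.a *ᵥ (algebraMap Rser Kser ∘ za) with hv
  set w := Q D.c *ᵥ (algebraMap Rser Kser ∘ zc) - v with hw
  have hPQ' : ∀ i x, P i *ᵥ (Q i *ᵥ x) = x := fun i x => by
    rw [Matrix.mulVec_mulVec, hPQ, Matrix.one_mulVec]
  have hva : P D.a *ᵥ (v - algebraMap Rser Kser (D.κ D.a) • w) = algebraMap Rser Kser ∘ za := by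
    rw [D.κa, map_zero, zero_smul, sub_zero, hv, hPQ']
  have hvb : P D.b *ᵥ (v - algebraMap Rser Kser (D.κ D.b) • w) = algebraMap Rser Kser ∘ zb := by
    have h1 : v - algebraMap Rser Kser (D.κ D.b) • w = Q D.b *ᵥ (algebraMap Rser Kser ∘ zb) := by
      rw [D.κb, map_one, one_smul, hw, sub_sub_eq_add_sub, ← two_smul Kser v, hz]
      abel
    rw [h1, hPQ']
  have hvc : P D.c *ᵥ (v - algebraMap Rser Kser (D.κ D.c) • w) = algebraMap Rser Kser ∘ zc := by
    have h1 : v - algebraMap Rser Kser (D.κ D.c) • w = Q D.c *ᵥ (algebraMap Rser Kser ∘ zc) := by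
      rw [D.κc, map_neg, map_one, neg_smul, one_smul, hw]
      abel
    rw [h1, hPQ']
  obtain ⟨G, hG⟩ := exists_hom_of_integral D hI hp Z hP v w (by
    intro i hi
    rcases (D.mem_iff i).1 hi with rfl | rfl | rfl
    · exact mem_integralVectors.2 ⟨_, hva⟩
    · exact mem_integralVectors.2 ⟨_, hvb⟩
    · exact mem_integralVectors.2 ⟨_, hvc⟩)
  have hGa : ∀ j, G.F D.a j 1 = za j := fun j =>
    IsFractionRing.injective Rser Kser
      (congrFun ((hG D.a ((D.mem_iff _).2 (Or.inl rfl))).trans hva) j)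
  obtain ⟨z, hz⟩ := exists_endTerm_end_constantCoeff D hI hp (f.comp G)
  have h11 : (f.comp G).F D.a 1 1 = f.F D.a 1 ⬝ᵥ za := by
    simp [CMHom.comp, CMHom.ofX, Matrix.mul_apply, dotProduct, hGa]
  rw [tser_dvd_iff, ← h11, (hz D.a).2.2]
  by_contra hz0
  have hu : ∀ i, IsUnit ((f.comp G).F i).det := fun i =>
    isUnit_det_of_constantCoeff hz0 (hz i).1 (hz i).2.1 (hz i).2.2
  refine hf ⟨G.comp ((f.comp G).inverse hu), fun i => ?_⟩
  change f.F i * (G.F i * ((f.comp G).F i)⁻¹) = 1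
  rw [← Matrix.mul_assoc]
  exact Matrix.mul_nonsing_inv _ (hu i)

end Lifting

section AlmostSplit

open scoped Matrix

variable {n s : ℕ} {I : Finset (ZMod n)} [NeZero n] (D : ArcData n I) (hI : I.card = 3)
  (hp : ∀ i ∈ I, i + 1 ∉ I)

theorem hom_endTerm_vecMul {Z : CMMod 3 n s} (f : CMHom Z (endTerm D hI hp)) (i : ZMod n) :
    f.F i 0 ᵥ* Z.X i = xVal (shift I 2) i • f.F (i - 1) 0 +
        (D.κ i - D.κ (i - 1)) • f.F (i - 1) 1 ∧
      f.F i 1 ᵥ* Z.X i = xVal (shift I 1) i • f.F (i - 1) 1 ∧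
      f.F (i - 1) 1 ᵥ* Z.Y i = yVal (shift I 1) i • f.F i 1 := by
  have h := fun u v => congrFun (congrFun (f.hX i) u) v
  have h' := fun u v => congrFun (congrFun (f.hY i) u) v
  refine ⟨funext fun j => (h 0 j).trans ?_, funext fun j => (h 1 j).trans ?_,
    funext fun j => (h' 1 j).trans ?_⟩ <;>
  simp [Matrix.mul_apply, Fin.sum_univ_two, endTerm, CMMod.ofDiagonalization]

/-- A family of rows that is integral along `I` and solves the lifting equation is integral. -/
theorem lift_mem_integralVectors {Z : CMMod 3 n s} (f : CMHom Z (endTerm D hI hp))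
    (g : ZMod n → Fin s → Kser)
    (hg : ∀ i, g i ᵥ* (Z.X i).map (algebraMap Rser Kser) =
      algebraMap Rser Kser (xVal I i) • g (i - 1) +
        algebraMap Rser Kser (D.μ i - D.μ (i - 1)) • (algebraMap Rser Kser ∘ f.F (i - 1) 1))
    (hgI : ∀ i ∈ I, g i ∈ integralVectors s) (i : ZMod n) : g i ∈ integralVectors s := by
  refine zmod_succ_induction (p := fun i => g i ∈ integralVectors s) D.a (hgI _ ((D.mem_iff _).2 (Or.inl rfl))) (fun i hi => ?_) i
  by_cases h : i ∈ I
  · exact hgI i h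
  have h1 := congrArg (· ᵥ* (Z.Y i).map (algebraMap Rser Kser)) (hg i)
  simp only [Matrix.vecMul_vecMul, map_algebraMap_mul_of_eq_smul_one (Z.hXY i),
    Matrix.add_vecMul, Matrix.smul_vecMul, map_comp_vecMul, (hom_endTerm_vecMul D hI hp f i).2.2]
    at h1
  rw [xVal, if_neg h] at h1
  have h2 : g i = g (i - 1) ᵥ* (Z.Y i).map (algebraMap Rser Kser) +
      algebraMap Rser Kser (D.μ i - D.μ (i - 1)) • (algebraMap Rser Kser ∘ f.F i 1) := by
    refine smul_right_injective _ tK_ne_zero ?_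
    simp only
    rw [Matrix.vecMul_smul, Matrix.vecMul_one] at h1
    rw [h1, smul_add]
    congr 1
    have h3 := jump_mul_yVal_add_one i D.hμ
    ext j
    have h4 := congrArg (algebraMap Rser Kser) h3
    simp only [map_mul] at h4
    simp only [Pi.smul_apply, Function.comp_apply, smul_eq_mul, map_mul, tK]
    linear_combination algebraMap Rser Kser (f.F i 1 j) * h4
  rw [h2]
  exact Submodule.add_mem _ (vecMul_mem _ hi)
    (algebraMap_smul_mem _ (mem_integralVectors.2 ⟨_, rfl⟩))

/-- An integral solution of the lifting equation gives a lift. -/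
theorem exists_lift_of_integral {Z : CMMod 3 n s} (f : CMHom Z (endTerm D hI hp))
    (g : ZMod n → Fin s → Kser)
    (hg : ∀ i, g i ᵥ* (Z.X i).map (algebraMap Rser Kser) =
      algebraMap Rser Kser (xVal I i) • g (i - 1) +
        algebraMap Rser Kser (D.μ i - D.μ (i - 1)) • (algebraMap Rser Kser ∘ f.F (i - 1) 1))
    (hgI : ∀ i ∈ I, g i ∈ integralVectors s) :
    ∃ l : CMHom Z (middleTerm D hI hp), ∀ i, (arSequence D hI hp).quo.F i * l.F i = f.F i := by
  choose z hz using fun i =>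
    mem_integralVectors.1 (lift_mem_integralVectors D hI hp f g hg hgI i)
  have hzX : ∀ i, z i ᵥ* Z.X i = xVal I i • z (i - 1) +
      (D.μ i - D.μ (i - 1)) • f.F (i - 1) 1 := by
    intro i
    have h := hg i
    rw [hz, hz, map_comp_vecMul] at h
    refine (IsFractionRing.injective Rser Kser).comp_left (h.trans (funext fun j => ?_))
    simp [Algebra.smul_def]
  refine ⟨CMHom.ofX (fun i => Matrix.of ![z i, f.F i 0, f.F i 1]) fun i => ?_, fun i => ?_⟩
  · obtain ⟨h0, h1, -⟩ := hom_endTerm_vecMul D hI hp f i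
    ext u v : 1
    rw [Matrix.mul_apply_eq_vecMul]
    fin_cases u
    · refine (congrFun (hzX i) v).trans ?_
      simp [Matrix.mul_apply, Fin.sum_univ_three, middleTerm, CMMod.ofDiagonalization]
    · refine (congrFun h0 v).trans ?_
      simp [Matrix.mul_apply, Fin.sum_univ_three, middleTerm, CMMod.ofDiagonalization]
    · refine (congrFun h1 v).trans ?_
      simp [Matrix.mul_apply, Fin.sum_univ_three, middleTerm, CMMod.ofDiagonalization]
  · ext u v : 1
    fin_cases u <;>
    simp [arSequence, CMses.ofSplitAtVertices, CMHom.ofX, Matrix.mul_apply, Fin.sum_univ_three]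

theorem mem_integralVectors_of_dotProduct {v : Fin s → Kser}
    (h : ∀ z : Fin s → Rser, v ⬝ᵥ (algebraMap Rser Kser ∘ z) ∈ (algebraMap Rser Kser).range) :
    v ∈ integralVectors s := by
  have h1 : ∀ j, ∃ r, algebraMap Rser Kser r = v j := by
    intro j
    obtain ⟨r, hr⟩ := h (Pi.single j 1)
    refine ⟨r, hr.trans ?_⟩
    have : algebraMap Rser Kser ∘ Pi.single j 1 = Pi.single j 1 := by
      ext i
      by_cases hij : i = j
      · subst hij; simp
      · simp [hij]
    rw [this, dotProduct_single_one]
  choose r hr using h1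
  exact mem_integralVectors.2 ⟨r, funext fun j => (hr j).symm⟩

theorem exists_lift {Z : CMMod 3 n s} (f : CMHom Z (endTerm D hI hp)) (hf : ¬ IsSplitEpi f) :
    ∃ l : CMHom Z (middleTerm D hI hp), ∀ i, (arSequence D hI hp).quo.F i * l.F i = f.F i := by
  obtain ⟨P, Q, hPQ, hQP, hP, hQ⟩ := exists_trivialization Z I hI
  have ha : D.a ∈ I := (D.mem_iff _).2 (Or.inl rfl)
  obtain ⟨θ, hθ⟩ : ∃ θ, ∀ i, algebraMap Rser Kser (xVal I i) •
      ((algebraMap Rser Kser ∘ f.F i 1) ᵥ* P i) = θ := by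
    refine ⟨_, fun i => zmod_const (f := fun i => algebraMap Rser Kser (xVal I i) •
      ((algebraMap Rser Kser ∘ f.F i 1) ᵥ* P i)) ?_ i 0⟩
    intro i
    rw [← Matrix.vecMul_smul, ← hP, ← Matrix.vecMul_vecMul, map_comp_vecMul,
      (hom_endTerm_vecMul D hI hp f i).2.1, xVal_shift_one]
    rw [← Matrix.smul_vecMul]
    congr 1
    ext j
    simp [Algebra.smul_def]
  have hθI : ∀ i ∈ I, θ ᵥ* Q i = algebraMap Rser Kser ∘ f.F i 1 := by
    intro i hi
    rw [← hθ i, xVal, if_pos hi, map_one, one_smul, Matrix.vecMul_vecMul, hPQ, Matrix.vecMul_one]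
  have hdot : ∀ y z : Fin s → Rser, (algebraMap Rser Kser ∘ y) ⬝ᵥ (algebraMap Rser Kser ∘ z) =
      algebraMap Rser Kser (y ⬝ᵥ z) := fun y z => (RingHom.map_dotProduct _ y z).symm
  let inc : (Fin s → Rser) →ₗ[Rser] (Fin s → Kser) := (Algebra.linearMap Rser Kser).compLeft _
  let V (i : ZMod n) : (Fin s → Rser) →ₗ[Rser] (Fin s → Kser) :=
    ((Q i).mulVecLin.restrictScalars Rser) ∘ₗ inc
  have hV : ∀ i z, V i z = Q i *ᵥ (algebraMap Rser Kser ∘ z) := fun i z => rfl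
  let Φ : (Fin s → Kser) →ₗ[Rser] Kser :=
    ((tK⁻¹ • dotProductEquiv Kser (Fin s) θ : Module.Dual Kser (Fin s → Kser))).restrictScalars Rser
  have hΦ : ∀ x, Φ x = tK⁻¹ * (θ ⬝ᵥ x) := fun x => rfl
  let σ : ((Fin s → Rser) × (Fin s → Rser) × (Fin s → Rser)) →ₗ[Rser] (Fin s → Kser) :=
    LinearMap.coprod ((2 : Rser) • V D.a) (LinearMap.coprod (-V D.b) (-V D.c))
  let l : ((Fin s → Rser) × (Fin s → Rser) × (Fin s → Rser)) →ₗ[Rser] Kser :=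
    ((2 : Rser) • Φ ∘ₗ V D.a) ∘ₗ LinearMap.fst _ _ _
  obtain ⟨ψ, hψ⟩ := exists_dual_add_mem_range (K := Kser) σ l (by
    rintro ⟨za, zb, zc⟩ hz
    have hz' : (2 : Kser) • Q D.a *ᵥ (algebraMap Rser Kser ∘ za) =
        Q D.b *ᵥ (algebraMap Rser Kser ∘ zb) + Q D.c *ᵥ (algebraMap Rser Kser ∘ zc) := by
      simp only [σ, LinearMap.coprod_apply, LinearMap.smul_apply, LinearMap.neg_apply, hV] at hz
      rw [← algebraMap_smul Kser (2 : Rser), map_ofNat] at hz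
      rw [← sub_eq_zero, ← hz]
      abel
    obtain ⟨r, hr⟩ := tser_dvd_of_not_isSplitEpi D hI hp f hf hPQ hP za zb zc hz'
    refine ⟨2 * r, ?_⟩
    change _ = (2 : Rser) • Φ (V D.a za)
    rw [hΦ, hV, Matrix.dotProduct_mulVec, hθI _ ha, hdot, hr, map_mul, map_mul,
      Algebra.smul_def, ← tK, ← mul_assoc tK⁻¹, inv_mul_cancel₀ tK_ne_zero, one_mul])
  obtain ⟨ψ, rfl⟩ := (dotProductEquiv Kser (Fin s)).surjective ψ
  have hψ' : ∀ z, l z + ψ ⬝ᵥ σ z ∈ (algebraMap Rser Kser).range := hψ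
  have hψa : ∀ z, (ψ + tK⁻¹ • θ) ⬝ᵥ (Q D.a *ᵥ (algebraMap Rser Kser ∘ z)) ∈
      (algebraMap Rser Kser).range := by
    intro z
    obtain ⟨r, hr⟩ := hψ' (z, 0, 0)
    have h2 : IsUnit (2 : Rser) := by
      rw [PowerSeries.isUnit_iff_constantCoeff, map_ofNat]
      norm_num
    obtain ⟨u, hu⟩ := h2.exists_left_inv
    refine ⟨u * r, ?_⟩
    have hu' := congrArg (algebraMap Rser Kser) hu
    rw [map_mul, map_one] at hu'
    have hσ : σ (z, 0, 0) = algebraMap Rser Kser 2 • (Q D.a *ᵥ (algebraMap Rser Kser ∘ z)) := by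
      rw [algebraMap_smul, ← hV]
      simp [σ]
    have hl : l (z, 0, 0) = algebraMap Rser Kser 2 *
        (tK⁻¹ * (θ ⬝ᵥ (Q D.a *ᵥ (algebraMap Rser Kser ∘ z)))) := by
      rw [← Algebra.smul_def]
      rfl
    rw [hσ, hl, dotProduct_smul, smul_eq_mul] at hr
    rw [map_mul, hr, add_dotProduct, smul_dotProduct, smul_eq_mul]
    linear_combination (ψ ⬝ᵥ (Q D.a *ᵥ (algebraMap Rser Kser ∘ z)) +
      tK⁻¹ * (θ ⬝ᵥ (Q D.a *ᵥ (algebraMap Rser Kser ∘ z)))) * hu'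
  have hψb : ∀ z, ψ ⬝ᵥ (Q D.b *ᵥ (algebraMap Rser Kser ∘ z)) ∈ (algebraMap Rser Kser).range := by
    intro z
    have h := hψ' (0, -z, 0)
    have hσ : σ (0, -z, 0) = V D.b z := by simp [σ]
    have hl : l (0, -z, 0) = 0 := by simp [l]
    rwa [hσ, hl, zero_add] at h
  have hψc : ∀ z, ψ ⬝ᵥ (Q D.c *ᵥ (algebraMap Rser Kser ∘ z)) ∈ (algebraMap Rser Kser).range := by
    intro z
    have h := hψ' (0, 0, -z)
    have hσ : σ (0, 0, -z) = V D.c z := by simp [σ]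
    have hl : l (0, 0, -z) = 0 := by simp [l]
    rwa [hσ, hl, zero_add] at h
  refine exists_lift_of_integral D hI hp f
    (fun i => (ψ + algebraMap Rser Kser (D.μ i) • tK⁻¹ • θ) ᵥ* Q i) (fun i => ?_) fun i hi => ?_
  · rw [Matrix.vecMul_vecMul, hQ, Matrix.vecMul_smul]
    by_cases h : i - 1 ∈ I
    · rw [← hθI _ h, xVal, if_neg (peak_sub_one hp h), ← tK, ← Matrix.smul_vecMul,
        ← Matrix.smul_vecMul, ← Matrix.smul_vecMul, ← Matrix.add_vecMul]
      congr 1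
      ext j
      have ht := mul_inv_cancel₀ tK_ne_zero
      simp only [Pi.smul_apply, Pi.add_apply, smul_eq_mul, map_sub]
      linear_combination (algebraMap Rser Kser (D.μ i) - algebraMap Rser Kser (D.μ (i - 1))) *
        θ j * ht
    · rw [D.hμ i h, sub_self, map_zero, zero_smul, add_zero]
  · refine mem_integralVectors_of_dotProduct fun z => ?_
    rw [← Matrix.dotProduct_mulVec]
    rcases (D.mem_iff i).1 hi with rfl | rfl | rfl
    · rw [D.μa, map_one, one_smul]
      exact hψa z
    · rw [D.μb, map_zero, zero_smul, add_zero]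
      exact hψb z
    · rw [D.μc, map_zero, zero_smul, add_zero]
      exact hψc z

end AlmostSplit

/-- If `I` is a `3`-subset of `ℤ/n` with three peaks (no two cyclically
adjacent elements), `X = I + 1` and `Y = I + 2`, then there is an almost split
sequence `0 → L_I → M → N → 0` with `N = L_X | L_Y` of rank 2 and `M` of rank 3;
if `M` is indecomposable, then `M = L_X | L_I | L_Y`. -/
theorem AR_sequence_three_peaks (n : ℕ) (hn : 6 ≤ n)
    (I : Finset (ZMod n)) (hI : I.card = 3) (hpeaks : ∀ i ∈ I, i + 1 ∉ I) :
    ∃ (A : CMMod 3 n 1) (M : CMMod 3 n 3) (N : CMMod 3 n 2),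
      IsRankOne I A ∧
      HasFiltration N [I.image (· + 1), I.image (· + 2)] ∧
      ∃ S : CMses A M N, AlmostSplit S ∧
        (Indecomposable M → HasFiltration M [I.image (· + 1), I, I.image (· + 2)]) := by
  have : NeZero n := ⟨by omega⟩
  obtain ⟨D⟩ := nonempty_arcData (by omega : 2 ≤ n) hI
  exact ⟨rankOne hI, middleTerm D hI hpeaks, endTerm D hI hpeaks, isRankOne_sumRankOne _ _,
    hasFiltration_endTerm D hI hpeaks, arSequence D hI hpeaks,
    ⟨not_splits_arSequence D hI hpeaks, indecomposable_rank_one hI,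
      indecomposable_endTerm D hI hpeaks, fun _ _ f hf => exists_lift D hI hpeaks f hf⟩,
    fun _ => hasFiltration_middleTerm D hI hpeaks⟩

end GCC
end
end
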